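/- For Algorithm I, θ^n_n → θ* almost surely as n → ∞. Moreover, for each p ∈ (0,1) there exists β > 0 such that for almost every ω there is n₀(ω) ∈ ℕ with the property that for all n ≥ n₀(ω) and all integers k with n^p ≤ k ≤ n, one has ‖θ^n_k − θ*‖ ≤ k^{−β}. -/

import Mathlib

open MeasureTheory ProbabilityTheory Filter Finset Matrix Topology

noncomputable section

namespace QSDPaper

/-- The simplex of probability vectors on `Fin d`, identified with `𝒫(Δ°)`. -/
def simplex (d : ℕ) : Set (Fin d → ℝ) :=
  {v | (∀ i, 0 ≤ v i) ∧ ∑ i, v i = 1}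

/-- The transition kernel `K[ν]` on `Δ° = Fin d`.  The full state space is
`Fin (d+1)`, with absorbing state `0` and `Δ°` embedded via `Fin.succ`;
`K[ν]_{x,y} = P_{x,y} + P_{x,0} ν(y)`. -/
def Kmat {d : ℕ} (P : Matrix (Fin (d + 1)) (Fin (d + 1)) ℝ) (ν : Fin d → ℝ) :
    Matrix (Fin d) (Fin d) ℝ :=
  Matrix.of fun x y => P x.succ y.succ + P x.succ 0 * ν y

/-- Standing assumptions: `P` is a stochastic matrix with absorbing state `0`,
`Δ°` is an irreducible class, absorption is possible from `Δ°`, and for every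
`ν` in the simplex, `pi ν` is the unique invariant distribution of `K[ν]`. -/
structure Setup (d : ℕ) (P : Matrix (Fin (d + 1)) (Fin (d + 1)) ℝ)
    (pi : (Fin d → ℝ) → Fin d → ℝ) : Prop where
  P_nonneg : ∀ x y, 0 ≤ P x y
  P_rowsum : ∀ x, ∑ y, P x y = 1
  P_absorb : P 0 0 = 1
  P_irred : ∀ x y : Fin d, ∃ n : ℕ,
    0 < ((Matrix.of fun x y : Fin d => P x.succ y.succ) ^ n) x y
  P_killed : ∃ x : Fin d, 0 < P x.succ 0
  pi_mem : ∀ ν ∈ simplex d, pi ν ∈ simplex d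
  pi_invariant : ∀ ν ∈ simplex d, ∀ y, ∑ x, pi ν x * Kmat P ν x y = pi ν y
  pi_unique : ∀ ν ∈ simplex d, ∀ w ∈ simplex d,
    (∀ y, ∑ x, w x * Kmat P ν x y = w y) → w = pi ν

/-- `θs` is the unique quasi-stationary distribution, i.e. the unique fixed
point of `pi` in the simplex. -/
structure IsQSD (d : ℕ) (P : Matrix (Fin (d + 1)) (Fin (d + 1)) ℝ)
    (pi : (Fin d → ℝ) → Fin d → ℝ) (θs : Fin d → ℝ) : Prop where
  mem : θs ∈ simplex d
  fixed : pi θs = θs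
  unique : ∀ w ∈ simplex d, pi w = w → w = θs

/-- Step sizes: `gam γs k = γ*/(k - 1 + N*)` with `N* = ⌊γ*⌋ + 1`, so that
`γ_{k+1} = γ*/(k + N*)` for `k ≥ 0`. -/
def gam (γs : ℝ) (k : ℕ) : ℝ := γs / ((k : ℝ) - 1 + (⌊γs⌋₊ + 1 : ℕ))

/-- Algorithm I: an array of interacting particle systems.  For each `n` there are
`a n` particles `X n k i` (`i < a n`), which, conditionally on the past, move
independently one step according to `K[θ^n_k]`, and the occupation measure
`θ^n_k = theta n k` is updated by `θ^n_{k+1} = (1-γ_{k+1}) θ^n_k + γ_{k+1} a(n)⁻¹ Σ_i δ_{X^{i,n}_{k+1}}`. -/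
structure AlgorithmI (d : ℕ) (P : Matrix (Fin (d + 1)) (Fin (d + 1)) ℝ)
    (γs : ℝ) (a : ℕ → ℕ) (x0 : Fin d)
    (Ω : Type) [m0 : MeasurableSpace Ω] (μ : Measure Ω) where
  F : ℕ → ℕ → MeasurableSpace Ω
  X : ℕ → ℕ → ℕ → Ω → Fin d
  theta : ℕ → ℕ → Ω → Fin d → ℝ
  F_le : ∀ n k, F n k ≤ m0
  F_mono : ∀ n, Monotone (F n)
  F_zero : ∀ n, F n 0 = ⊥
  F_succ : ∀ n k, F n (k + 1) =
    F n k ⊔ ⨆ i ∈ Set.Iio (a n), MeasurableSpace.comap (X n (k + 1) i) ⊤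
  X_adapted : ∀ n k i, Measurable[F n k] (X n k i)
  theta_adapted : ∀ n k, Measurable[F n k] (theta n k)
  X_zero : ∀ n i ω, X n 0 i ω = x0
  theta_zero : ∀ n ω, theta n 0 ω = fun y => if y = x0 then (1 : ℝ) else 0
  law : ∀ n k (y : ℕ → Fin d),
    (μ[Set.indicator {ω | ∀ i < a n, X n (k + 1) i ω = y i} (fun _ => (1 : ℝ)) | F n k])
      =ᵐ[μ] fun ω => ∏ i ∈ Finset.range (a n), Kmat P (theta n k ω) (X n k i ω) (y i)
  theta_rec : ∀ n k ω x, theta n (k + 1) ω x =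
    (1 - gam γs (k + 1)) * theta n k ω x +
      gam γs (k + 1) * (a n : ℝ)⁻¹ *
        ∑ i ∈ Finset.range (a n), if X n (k + 1) i ω = x then (1 : ℝ) else 0

section Perron

variable {ι : Type*} [Fintype ι] [DecidableEq ι]

/-- Minimum principle for an irreducible, strictly substochastic matrix. -/
lemma eq_zero_or_pos_of_mulVec_le [Nonempty ι] {Q : Matrix ι ι ℝ} (hQ : ∀ x y, 0 ≤ Q x y)
    (hrow : ∀ x, ∑ y, Q x y ≤ 1) (hirr : ∀ x y, ∃ n : ℕ, 0 < (Q ^ n) x y)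
    (hkill : ∃ x, ∑ y, Q x y < 1) {v : ι → ℝ} (hv : ∀ x, (Q *ᵥ v) x ≤ v x) :
    v = 0 ∨ ∀ x, 0 < v x := by
  obtain ⟨m, hm⟩ := Finite.exists_min v
  by_cases hpos : 0 < v m
  · exact Or.inr fun x => hpos.trans_le (hm x)
  push Not at hpos
  have hpow : ∀ n : ℕ, (∀ x y, 0 ≤ (Q ^ n) x y) ∧ (∀ x, ∑ y, (Q ^ n) x y ≤ 1) ∧
      ∀ x, ((Q ^ n) *ᵥ v) x ≤ v x := by
    intro n
    induction n with
    | zero => 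
      refine ⟨fun x y => ?_, fun x => ?_, fun x => ?_⟩
      · simp only [pow_zero, Matrix.one_apply]; split_ifs <;> norm_num
      · simp [Matrix.one_apply]
      · simp
    | succ n ih =>
      obtain ⟨h1, h2, h3⟩ := ih
      refine ⟨fun x y => ?_, fun x => ?_, fun x => ?_⟩
      · rw [pow_succ, Matrix.mul_apply]
        exact Finset.sum_nonneg fun z _ => mul_nonneg (h1 _ _) (hQ _ _)
      · calc ∑ y, (Q ^ (n + 1)) x y = ∑ z, (Q ^ n) x z * ∑ y, Q z y := by
              simp only [pow_succ, Matrix.mul_apply, Finset.mul_sum]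
              exact Finset.sum_comm
          _ ≤ ∑ z, (Q ^ n) x z * 1 :=
              Finset.sum_le_sum fun z _ => mul_le_mul_of_nonneg_left (hrow z) (h1 x z)
          _ ≤ 1 := by simpa using h2 x
      · rw [pow_succ, ← Matrix.mulVec_mulVec]
        refine le_trans ?_ (h3 x)
        exact Finset.sum_le_sum fun z _ => mul_le_mul_of_nonneg_left (hv z) (h1 x z)
  have hconst : ∀ y, v y = v m := by
    intro y
    obtain ⟨n, hn⟩ := hirr m y
    obtain ⟨h1, h2, h3⟩ := hpow n
    have h4 : (Q ^ n) m y * (v y - v m) ≤ ∑ z, (Q ^ n) m z * (v z - v m) :=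
      Finset.single_le_sum (f := fun z => (Q ^ n) m z * (v z - v m))
        (fun z _ => mul_nonneg (h1 m z) (sub_nonneg.2 (hm z))) (Finset.mem_univ y)
    have h5 : ∑ z, (Q ^ n) m z * (v z - v m) =
        ((Q ^ n) *ᵥ v) m - (∑ z, (Q ^ n) m z) * v m := by
      simp [Matrix.mulVec, dotProduct, mul_sub, Finset.sum_mul]
    have h6 := h3 m
    have h7 : v m ≤ (∑ z, (Q ^ n) m z) * v m := by nlinarith [h2 m]
    have h8 : (Q ^ n) m y * (v y - v m) ≤ 0 := by linarith
    have h9 : v y - v m ≤ 0 := by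
      by_contra! h
      exact absurd (mul_pos hn h) (not_lt.2 h8)
    linarith [hm y]
  obtain ⟨x, hx⟩ := hkill
  have h1 : (∑ y, Q x y) * v m ≤ v m := by
    have := hv x
    simpa [Matrix.mulVec, dotProduct, hconst, Finset.sum_mul] using this
  have h2 : v m = 0 := by nlinarith
  exact Or.inl (funext fun y => by rw [hconst y, h2]; rfl)

/-- The Green matrix of an irreducible, strictly substochastic matrix is positive. -/
lemma exists_pos_inverse [Nonempty ι] {Q : Matrix ι ι ℝ} (hQ : ∀ x y, 0 ≤ Q x y)
    (hrow : ∀ x, ∑ y, Q x y ≤ 1) (hirr : ∀ x y, ∃ n : ℕ, 0 < (Q ^ n) x y)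
    (hkill : ∃ x, ∑ y, Q x y < 1) :
    ∃ G : Matrix ι ι ℝ, (1 - Q) * G = 1 ∧ ∀ x y, 0 < G x y := by
  have key := fun {v : ι → ℝ} => eq_zero_or_pos_of_mulVec_le hQ hrow hirr hkill (v := v)
  have hdet : IsUnit (1 - Q).det := by
    rw [isUnit_iff_ne_zero]
    intro h0
    obtain ⟨v, hv0, hv⟩ := Matrix.exists_mulVec_eq_zero_iff.2 h0
    rw [Matrix.sub_mulVec, Matrix.one_mulVec, sub_eq_zero] at hv
    obtain ⟨x⟩ := ‹Nonempty ι›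
    rcases key (v := v) (fun x => (congrFun hv x).ge) with h | h
    · exact hv0 h
    rcases key (v := -v) (fun x => by rw [Matrix.mulVec_neg, ← hv]) with h' | h'
    · exact hv0 (neg_eq_zero.1 h')
    · have := h x
      have := h' x
      simp only [Pi.neg_apply] at this
      linarith
  refine ⟨(1 - Q)⁻¹, Matrix.mul_nonsing_inv _ hdet, fun x y => ?_⟩
  have hG : (1 - Q) *ᵥ ((1 - Q)⁻¹ *ᵥ Pi.single y 1) = Pi.single y 1 := by
    rw [Matrix.mulVec_mulVec, Matrix.mul_nonsing_inv _ hdet, Matrix.one_mulVec]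
  have hcol : ((1 - Q)⁻¹ *ᵥ Pi.single y 1) x = (1 - Q)⁻¹ x y := by simp
  rcases key (v := (1 - Q)⁻¹ *ᵥ Pi.single y 1) (fun z => by
    have := congrFun hG z
    rw [Matrix.sub_mulVec, Matrix.one_mulVec, Pi.sub_apply] at this
    have h2 : (0 : ℝ) ≤ (Pi.single y 1 : ι → ℝ) z := by
      by_cases h : z = y
      · subst h; simp
      · simp [h]
    linarith) with h | h
  · rw [h, Matrix.mulVec_zero] at hG
    have := congrFun hG y
    simp at this
  · rw [← hcol]; exact h x

/-- Perron eigenvectors of a positive matrix `G`, normalised by `∑ θ = 1` and `θ ⬝ u = 1`,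
with a Doeblin constant `ε`. -/
structure PerronData (G : Matrix ι ι ℝ) (θ u : ι → ℝ) (g ε : ℝ) : Prop where
  G_pos : ∀ x y, 0 < G x y
  g_pos : 0 < g
  u_pos : ∀ x, 0 < u x
  left_nonneg : ∀ x, 0 ≤ θ x
  left_sum : ∑ x, θ x = 1
  pairing : θ ⬝ᵥ u = 1
  left_eigen : θ ᵥ* G = g • θ
  right_eigen : G *ᵥ u = g • u
  eps_pos : 0 < ε
  eps_le_one : ε ≤ 1
  doeblin : ∀ x y, ε * g * u x * θ y ≤ G x y

lemma exists_perronData [Nonempty ι] {G : Matrix ι ι ℝ} (hG : ∀ x y, 0 < G x y) {θ : ι → ℝ}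
    (hθ : ∀ x, 0 ≤ θ x) (hsum : ∑ x, θ x = 1) {g : ℝ} (hg : 0 < g) (heig : θ ᵥ* G = g • θ) :
    ∃ u ε, PerronData G θ u g ε := by
  have hθne : θ ≠ 0 := by rintro rfl; simp at hsum
  have hθpos : ∀ y, 0 < θ y := by
    intro y
    obtain ⟨x, hx⟩ : ∃ x, θ x ≠ 0 := Function.ne_iff.1 hθne
    have h1 : 0 < (θ ᵥ* G) y :=
      Finset.sum_pos' (fun z _ => mul_nonneg (hθ z) (hG z y).le)
        ⟨x, Finset.mem_univ x, mul_pos ((hθ x).lt_of_ne' hx) (hG x y)⟩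
    rw [heig, Pi.smul_apply, smul_eq_mul] at h1
    exact pos_of_mul_pos_right h1 hg.le
  have hdet : (G - g • (1 : Matrix ι ι ℝ)).det = 0 := by
    refine Matrix.exists_vecMul_eq_zero_iff.1 ⟨θ, hθne, ?_⟩
    rw [Matrix.vecMul_sub, heig, Matrix.vecMul_smul, Matrix.vecMul_one, sub_self]
  obtain ⟨v, hv0, hv⟩ := Matrix.exists_mulVec_eq_zero_iff.2 hdet
  rw [Matrix.sub_mulVec, Matrix.smul_mulVec, Matrix.one_mulVec, sub_eq_zero] at hv
  have habs : ∀ x, g * |v x| ≤ (G *ᵥ fun y => |v y|) x := by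
    intro x
    calc g * |v x| = |(G *ᵥ v) x| := by rw [hv, Pi.smul_apply, smul_eq_mul, abs_mul, abs_of_pos hg]
      _ ≤ ∑ y, |G x y * v y| := Finset.abs_sum_le_sum_abs _ _
      _ = _ := Finset.sum_congr rfl fun y _ => by rw [abs_mul, abs_of_pos (hG x y)]
  have hpair : ∑ x, θ x * ((G *ᵥ fun y => |v y|) x - g * |v x|) = 0 := by
    have h1 : θ ⬝ᵥ (G *ᵥ fun y => |v y|) = g * (θ ⬝ᵥ fun y => |v y|) := by
      rw [Matrix.dotProduct_mulVec, heig, smul_dotProduct, smul_eq_mul]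
    simp only [mul_sub, Finset.sum_sub_distrib]
    rw [sub_eq_zero]
    refine h1.trans ?_
    simp only [dotProduct, Finset.mul_sum]
    exact Finset.sum_congr rfl fun x _ => by ring
  have heq : ∀ x, (G *ᵥ fun y => |v y|) x = g * |v x| := by
    intro x
    have := (Finset.sum_eq_zero_iff_of_nonneg fun x _ =>
      mul_nonneg (hθ x) (sub_nonneg.2 (habs x))).1 hpair x (Finset.mem_univ x)
    rcases mul_eq_zero.1 this with h | h
    · exact absurd h (hθpos x).ne'
    · linarith
  have hvpos : ∀ x, 0 < |v x| := by
    intro x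
    obtain ⟨y, hy⟩ : ∃ y, v y ≠ 0 := Function.ne_iff.1 hv0
    have h1 : 0 < (G *ᵥ fun y => |v y|) x :=
      Finset.sum_pos' (fun z _ => mul_nonneg (hG x z).le (abs_nonneg _))
        ⟨y, Finset.mem_univ y, mul_pos (hG x y) (abs_pos.2 hy)⟩
    rw [heq] at h1
    exact pos_of_mul_pos_right h1 hg.le
  set s := θ ⬝ᵥ fun y => |v y| with hs
  have hspos : 0 < s := Finset.sum_pos (fun x _ => mul_pos (hθpos x) (hvpos x)) Finset.univ_nonempty
  set u : ι → ℝ := s⁻¹ • fun y => |v y| with hu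
  have hupos : ∀ x, 0 < u x := fun x => mul_pos (inv_pos.2 hspos) (hvpos x)
  obtain ⟨q, hq⟩ := Finite.exists_min fun q : ι × ι => G q.1 q.2 / (g * u q.1 * θ q.2)
  have hden : ∀ x y, 0 < g * u x * θ y := fun x y => mul_pos (mul_pos hg (hupos x)) (hθpos y)
  refine ⟨u, min 1 (G q.1 q.2 / (g * u q.1 * θ q.2)), hG, hg, hupos, hθ, hsum, ?_, heig, ?_,
    lt_min one_pos (div_pos (hG _ _) (hden _ _)), min_le_left _ _, fun x y => ?_⟩
  · rw [hu, dotProduct_smul, ← hs, smul_eq_mul, inv_mul_cancel₀ hspos.ne']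
  · rw [hu, Matrix.mulVec_smul, smul_comm]
    congr 1
    exact funext heq
  · have h1 := (min_le_right 1 _).trans (hq (x, y))
    rw [le_div_iff₀ (hden x y)] at h1
    simpa only [mul_assoc] using h1

end Perron

section Lyapunov

variable {ι : Type*} [Fintype ι]

/-- Weighted `ℓ¹` distance from `z` to its projection along `θ` parallel to `{· ⬝ u = 0}`. -/
def deviation (θ u z : ι → ℝ) : ℝ := ∑ x, u x * |z x - (z ⬝ᵥ u) * θ x|

lemma abs_dotProduct_le {u : ι → ℝ} (hu : ∀ x, 0 ≤ u x) (v : ι → ℝ) :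
    |v ⬝ᵥ u| ≤ ‖v‖ * ∑ x, u x := by
  calc |v ⬝ᵥ u| ≤ ∑ x, |v x * u x| := Finset.abs_sum_le_sum_abs _ _
    _ ≤ ∑ x, ‖v‖ * u x := Finset.sum_le_sum fun x _ => by
        rw [abs_mul, abs_of_nonneg (hu x)]
        exact mul_le_mul_of_nonneg_right (norm_le_pi_norm v x) (hu x)
    _ = _ := (Finset.mul_sum _ _ _).symm

lemma norm_vecMul_le {G : Matrix ι ι ℝ} (hG : ∀ x y, 0 ≤ G x y) (v : ι → ℝ) :
    ‖v ᵥ* G‖ ≤ ‖v‖ * ∑ y, ∑ x, G x y := by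
  have h0 : ∀ y, 0 ≤ ∑ x, G x y := fun y => Finset.sum_nonneg fun x _ => hG x y
  refine (pi_norm_le_iff_of_nonneg
    (mul_nonneg (norm_nonneg _) (Finset.sum_nonneg fun y _ => h0 y))).2 fun y => ?_
  refine (abs_dotProduct_le (fun x => hG x y) v).trans ?_
  exact mul_le_mul_of_nonneg_left
    (Finset.single_le_sum (f := fun y => ∑ x, G x y) (fun y _ => h0 y) (Finset.mem_univ y))
    (norm_nonneg _)

lemma deviation_nonneg {θ u : ι → ℝ} (hu : ∀ x, 0 ≤ u x) (z : ι → ℝ) : 0 ≤ deviation θ u z :=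
  Finset.sum_nonneg fun x _ => mul_nonneg (hu x) (abs_nonneg _)

lemma deviation_add_le {θ u : ι → ℝ} (hu : ∀ x, 0 ≤ u x) (z w : ι → ℝ) :
    deviation θ u (z + w) ≤ deviation θ u z + deviation θ u w := by
  rw [deviation, deviation, deviation, ← Finset.sum_add_distrib]
  refine Finset.sum_le_sum fun x _ => ?_
  rw [← mul_add]
  refine mul_le_mul_of_nonneg_left ?_ (hu x)
  refine le_trans (le_of_eq ?_) (abs_add_le _ _)
  rw [add_dotProduct, Pi.add_apply]
  congr 1; ring

lemma deviation_smul {θ u : ι → ℝ} {s : ℝ} (hs : 0 ≤ s) (z : ι → ℝ) :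
    deviation θ u (s • z) = s * deviation θ u z := by
  rw [deviation, deviation, Finset.mul_sum]
  refine Finset.sum_congr rfl fun x _ => ?_
  rw [smul_dotProduct, Pi.smul_apply, smul_eq_mul, smul_eq_mul, mul_assoc, ← mul_sub, abs_mul,
    abs_of_nonneg hs]
  ring

lemma deviation_le_norm {θ u : ι → ℝ} (hu : ∀ x, 0 ≤ u x) (hθ : ∀ x, 0 ≤ θ x)
    (hsum : ∑ x, θ x = 1) (z : ι → ℝ) :
    deviation θ u z ≤ (∑ x, u x) * (1 + ∑ x, u x) * ‖z‖ := by
  have hθ1 : ∀ x, θ x ≤ 1 := fun x =>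
    hsum ▸ Finset.single_le_sum (fun y _ => hθ y) (Finset.mem_univ x)
  have h : ∀ x, |z x - (z ⬝ᵥ u) * θ x| ≤ (1 + ∑ x, u x) * ‖z‖ := by
    intro x
    have h1 : |z x| ≤ ‖z‖ := norm_le_pi_norm z x
    have h2 : |(z ⬝ᵥ u) * θ x| ≤ ‖z‖ * ∑ x, u x := by
      rw [abs_mul, abs_of_nonneg (hθ x)]
      exact (mul_le_of_le_one_right (abs_nonneg _) (hθ1 x)).trans (abs_dotProduct_le hu z)
    linarith [abs_sub (z x) ((z ⬝ᵥ u) * θ x)]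
  calc deviation θ u z ≤ ∑ x, u x * ((1 + ∑ x, u x) * ‖z‖) :=
        Finset.sum_le_sum fun x _ => mul_le_mul_of_nonneg_left (h x) (hu x)
    _ = _ := by rw [← Finset.sum_mul, mul_assoc]

variable {G : Matrix ι ι ℝ} {θ u : ι → ℝ} {g ε : ℝ}

lemma PerronData.vecMul_dotProduct (h : PerronData G θ u g ε) (z : ι → ℝ) :
    (z ᵥ* G) ⬝ᵥ u = g * (z ⬝ᵥ u) := by
  rw [← Matrix.dotProduct_mulVec, h.right_eigen, dotProduct_smul, smul_eq_mul]

lemma PerronData.deviation_vecMul_le (h : PerronData G θ u g ε) (z : ι → ℝ) :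
    deviation θ u (z ᵥ* G) ≤ g * (1 - ε) * deviation θ u z := by
  set w : ι → ℝ := fun x => z x - (z ⬝ᵥ u) * θ x with hw
  have hwu : w ⬝ᵥ u = 0 := by
    have : w = z - (z ⬝ᵥ u) • θ := rfl
    rw [this, sub_dotProduct, smul_dotProduct, h.pairing, smul_eq_mul, mul_one, sub_self]
  have hwG : ∀ y, (z ᵥ* G) y - ((z ᵥ* G) ⬝ᵥ u) * θ y =
      ∑ x, w x * (G x y - ε * g * u x * θ y) := by
    intro y
    have h1 : ∑ x, w x * (G x y - ε * g * u x * θ y) =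
        (w ᵥ* G) y - ε * g * θ y * (w ⬝ᵥ u) := by
      simp only [Matrix.vecMul, dotProduct, mul_sub, Finset.sum_sub_distrib, Finset.mul_sum]
      congr 1
      exact Finset.sum_congr rfl fun x _ => by ring
    have h2 : w = z - (z ⬝ᵥ u) • θ := rfl
    rw [h1, hwu, h.vecMul_dotProduct, h2, Matrix.sub_vecMul, Matrix.smul_vecMul, h.left_eigen]
    simp only [Pi.sub_apply, Pi.smul_apply, smul_eq_mul]
    ring
  calc deviation θ u (z ᵥ* G) = ∑ y, u y * |∑ x, w x * (G x y - ε * g * u x * θ y)| :=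
        Finset.sum_congr rfl fun y _ => by rw [hwG]
    _ ≤ ∑ y, u y * ∑ x, |w x| * (G x y - ε * g * u x * θ y) := by
        refine Finset.sum_le_sum fun y _ => mul_le_mul_of_nonneg_left ?_ (h.u_pos y).le
        refine (Finset.abs_sum_le_sum_abs _ _).trans_eq (Finset.sum_congr rfl fun x _ => ?_)
        rw [abs_mul, abs_of_nonneg (sub_nonneg.2 (h.doeblin x y))]
    _ = ∑ x, |w x| * ((G *ᵥ u) x - ε * g * u x * (θ ⬝ᵥ u)) := by
        simp only [Finset.mul_sum]
        rw [Finset.sum_comm]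
        refine Finset.sum_congr rfl fun x _ => ?_
        simp only [Matrix.mulVec, dotProduct, mul_sub, Finset.mul_sum, Finset.sum_sub_distrib]
        congr 1 <;> exact Finset.sum_congr rfl fun y _ => by ring
    _ = g * (1 - ε) * deviation θ u z := by
        rw [h.pairing, h.right_eigen, deviation, Finset.mul_sum]
        refine Finset.sum_congr rfl fun x _ => ?_
        simp only [Pi.smul_apply, smul_eq_mul, hw]
        ring

lemma PerronData.norm_sub_le_deviation (h : PerronData G θ u g ε) {m : ℝ} (hm : 0 < m)
    (hmu : ∀ x, m ≤ u x) {z : ι → ℝ} (hz : ∑ x, z x = 1) :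
    ‖z - θ‖ ≤ (1 + Fintype.card ι) / m * deviation θ u z := by
  have hD := deviation_nonneg (θ := θ) (fun x => (h.u_pos x).le) z
  have h1 : ∀ x, |z x - (z ⬝ᵥ u) * θ x| ≤ deviation θ u z / m := by
    intro x
    rw [le_div_iff₀ hm, mul_comm]
    refine (mul_le_mul_of_nonneg_right (hmu x) (abs_nonneg _)).trans ?_
    exact Finset.single_le_sum (f := fun x => u x * |z x - (z ⬝ᵥ u) * θ x|)
      (fun y _ => mul_nonneg (h.u_pos y).le (abs_nonneg _)) (Finset.mem_univ x)
  have h2 : |1 - z ⬝ᵥ u| ≤ Fintype.card ι * (deviation θ u z / m) := by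
    have : 1 - z ⬝ᵥ u = ∑ x, (z x - (z ⬝ᵥ u) * θ x) := by
      rw [Finset.sum_sub_distrib, ← Finset.mul_sum, hz, h.left_sum, mul_one]
    rw [this]
    refine (Finset.abs_sum_le_sum_abs _ _).trans ?_
    refine (Finset.sum_le_sum fun x _ => h1 x).trans_eq ?_
    simp
  refine (pi_norm_le_iff_of_nonneg (by positivity)).2 fun x => ?_
  have hθ1 : θ x ≤ 1 := h.left_sum ▸
    Finset.single_le_sum (fun y _ => h.left_nonneg y) (Finset.mem_univ x)
  have h3 : (z - θ) x = (z x - (z ⬝ᵥ u) * θ x) - (1 - z ⬝ᵥ u) * θ x := by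
    simp only [Pi.sub_apply]; ring
  have h4 : |(1 - z ⬝ᵥ u) * θ x| ≤ |1 - z ⬝ᵥ u| := by
    rw [abs_mul, abs_of_nonneg (h.left_nonneg x)]
    exact mul_le_of_le_one_right (abs_nonneg _) hθ1
  rw [h3, Real.norm_eq_abs]
  refine (abs_sub _ _).trans ?_
  calc _ ≤ deviation θ u z / m + Fintype.card ι * (deviation θ u z / m) :=
        add_le_add (h1 x) (h4.trans h2)
    _ = _ := by ring

/-- One perturbed step of the projective dynamics contracts the Lyapunov quotient
`deviation / (· ⬝ u)`. -/
lemma PerronData.quotient_step (h : PerronData G θ u g ε) {s t : ℝ} (hs : 0 ≤ s) (ht : 0 ≤ t)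
    (hs1 : s ≤ 1) (ht1 : t ≤ 1) {z r : ι → ℝ} {e φ V : ℝ} (he : 0 ≤ e)
    (hdev : deviation θ u r ≤ e) (hru : |r ⬝ᵥ u| ≤ e) (hφ : 0 < φ) (hz : φ ≤ z ⬝ᵥ u)
    (hz' : φ ≤ (s • z + t • (z ᵥ* G) + r) ⬝ᵥ u)
    (hV : deviation θ u z / (z ⬝ᵥ u) ≤ V) :
    deviation θ u (s • z + t • (z ᵥ* G) + r) / ((s • z + t • (z ᵥ* G) + r) ⬝ᵥ u) ≤
      (1 - g * ε / (1 + g) * t) * (deviation θ u z / (z ⬝ᵥ u)) + (V + 1) * e / φ := by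
  have hu : ∀ x, 0 ≤ u x := fun x => (h.u_pos x).le
  have hg := h.g_pos
  have hzpos : 0 < z ⬝ᵥ u := hφ.trans_le hz
  set z' := s • z + t • (z ᵥ* G) + r with hz'def
  have hz'pos : 0 < z' ⬝ᵥ u := hφ.trans_le hz'
  set κ := g * ε / (1 + g) with hκ
  have hκ0 : 0 < κ := div_pos (mul_pos hg h.eps_pos) (by linarith)
  have hκg : κ * (1 + g) = g * ε := div_mul_cancel₀ _ (by linarith)
  have hκ1 : κ ≤ 1 := by
    rw [hκ, div_le_one (by linarith)]
    nlinarith [h.eps_le_one]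
  set q := deviation θ u z / (z ⬝ᵥ u) with hq
  have hq0 : 0 ≤ q := div_nonneg (deviation_nonneg hu z) hzpos.le
  have hqz : deviation θ u z = q * (z ⬝ᵥ u) := (div_mul_cancel₀ _ hzpos.ne').symm
  have hφ' : z' ⬝ᵥ u = (s + t * g) * (z ⬝ᵥ u) + r ⬝ᵥ u := by
    rw [hz'def, add_dotProduct, add_dotProduct, smul_dotProduct, smul_dotProduct,
      h.vecMul_dotProduct, smul_eq_mul, smul_eq_mul]
    ring
  have hW : deviation θ u z' ≤ (s + t * g - t * (g * ε)) * (q * (z ⬝ᵥ u)) + e := by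
    have h1 := deviation_add_le (θ := θ) hu (s • z + t • (z ᵥ* G)) r
    have h2 := deviation_add_le (θ := θ) hu (s • z) (t • (z ᵥ* G))
    rw [deviation_smul hs, deviation_smul ht] at h2
    have h3 := mul_le_mul_of_nonneg_left (h.deviation_vecMul_le z) ht
    rw [← hqz]
    nlinarith
  have hcoef : s + t * g - t * (g * ε) ≤ (1 - κ * t) * (s + t * g) := by
    have : κ * (s + t * g) ≤ g * ε := by
      rw [← hκg]
      exact mul_le_mul_of_nonneg_left (by nlinarith) hκ0.le
    nlinarith
  have hκt : 0 ≤ 1 - κ * t := by nlinarith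
  have hκt1 : 1 - κ * t ≤ 1 := by nlinarith
  have hmain : deviation θ u z' ≤ (1 - κ * t) * q * (z' ⬝ᵥ u) + (V + 1) * e := by
    have h1 : (s + t * g - t * (g * ε)) * (q * (z ⬝ᵥ u)) ≤
        (1 - κ * t) * (s + t * g) * (q * (z ⬝ᵥ u)) :=
      mul_le_mul_of_nonneg_right hcoef (mul_nonneg hq0 hzpos.le)
    have h2 : (1 - κ * t) * (s + t * g) * (q * (z ⬝ᵥ u)) =
        (1 - κ * t) * q * (z' ⬝ᵥ u) - (1 - κ * t) * q * (r ⬝ᵥ u) := by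
      rw [hφ']; ring
    have h3 : -((1 - κ * t) * q * (r ⬝ᵥ u)) ≤ V * e := by
      have h4 : 0 ≤ (1 - κ * t) * q := mul_nonneg hκt hq0
      have h5 : (1 - κ * t) * q ≤ V := (mul_le_of_le_one_left hq0 hκt1).trans hV
      have h6 : -(r ⬝ᵥ u) ≤ e := (neg_le_abs _).trans hru
      calc -((1 - κ * t) * q * (r ⬝ᵥ u)) = (1 - κ * t) * q * -(r ⬝ᵥ u) := by ring
        _ ≤ (1 - κ * t) * q * e := mul_le_mul_of_nonneg_left h6 h4
        _ ≤ V * e := mul_le_mul_of_nonneg_right h5 he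
    linarith
  have hV0 : 0 ≤ V := hq0.trans hV
  calc deviation θ u z' / (z' ⬝ᵥ u)
      ≤ ((1 - κ * t) * q * (z' ⬝ᵥ u) + (V + 1) * e) / (z' ⬝ᵥ u) :=
        div_le_div_of_nonneg_right hmain hz'pos.le
    _ = (1 - κ * t) * q + (V + 1) * e / (z' ⬝ᵥ u) := by
        rw [add_div, mul_div_cancel_right₀ _ hz'pos.ne']
    _ ≤ _ := by
        have : (V + 1) * e / (z' ⬝ᵥ u) ≤ (V + 1) * e / φ :=
          div_le_div_of_nonneg_left (by positivity) hφ hz'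
        linarith

/-- Solving the scalar recursion `v (i+1) ≤ (1 - κ t i) v i + b i`. -/
lemma le_exp_of_recursion {v t b : ℕ → ℝ} {κ : ℝ} {j l : ℕ} (hjl : j ≤ l) (hκ : 0 ≤ κ)
    (ht : ∀ i, 0 ≤ t i) (hb : ∀ i, 0 ≤ b i) (hv : ∀ i, j ≤ i → i ≤ l → 0 ≤ v i)
    (hrec : ∀ i, j ≤ i → i < l → v (i + 1) ≤ (1 - κ * t i) * v i + b i) :
    v l ≤ Real.exp (-κ * ∑ i ∈ Finset.Ico j l, t i) * v j + ∑ i ∈ Finset.Ico j l, b i := by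
  induction l, hjl using Nat.le_induction with
  | base => simp
  | succ l hjl ih =>
    have h1 := ih (fun i h h' => hv i h (by omega)) (fun i h h' => hrec i h (by omega))
    have h2 := hrec l hjl (by omega)
    have h3 : (1 - κ * t l) ≤ Real.exp (-κ * t l) := by
      have := Real.add_one_le_exp (-κ * t l)
      linarith
    have h4 : Real.exp (-κ * t l) ≤ 1 :=
      Real.exp_le_one_iff.2 (by nlinarith [mul_nonneg hκ (ht l)])
    have hB : 0 ≤ ∑ i ∈ Finset.Ico j l, b i := Finset.sum_nonneg fun i _ => hb i
    rw [Finset.sum_Ico_succ_top hjl, Finset.sum_Ico_succ_top hjl, mul_add, Real.exp_add]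
    have h5 : (1 - κ * t l) * v l ≤ Real.exp (-κ * t l) * v l :=
      mul_le_mul_of_nonneg_right h3 (hv l hjl (by omega))
    have h6 := mul_le_mul_of_nonneg_left h1 (Real.exp_pos (-κ * t l)).le
    have h7 : Real.exp (-κ * t l) * ∑ i ∈ Finset.Ico j l, b i ≤ ∑ i ∈ Finset.Ico j l, b i :=
      mul_le_of_le_one_left hB h4
    nlinarith


lemma exists_pos_le {α : Type*} [Finite α] [Nonempty α] {u : α → ℝ} (hu : ∀ x, 0 < u x) :
    ∃ m, 0 < m ∧ ∀ x, m ≤ u x := by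
  obtain ⟨x, hx⟩ := Finite.exists_min u
  exact ⟨u x, hu x, hx⟩

lemma norm_le_one_of_mem_simplex {v : ι → ℝ} (h0 : ∀ x, 0 ≤ v x)
    (h1 : ∑ x, v x = 1) : ‖v‖ ≤ 1 := by
  refine (pi_norm_le_iff_of_nonneg zero_le_one).2 fun x => ?_
  rw [Real.norm_eq_abs, abs_of_nonneg (h0 x)]
  exact h1 ▸ Finset.single_le_sum (fun y _ => h0 y) (Finset.mem_univ x)

/-- A sequence of probability vectors following `θ' = c • θ G - θ` up to a perturbation whose
accumulated size stays below `δ` approaches the left Perron eigenvector. -/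
lemma PerronData.exists_norm_sub_le [Nonempty ι] (h : PerronData G θ u g ε) :
    ∃ C κ δ₀ : ℝ, 0 < C ∧ 0 < κ ∧ 0 < δ₀ ∧
      ∀ (ϑ η : ℕ → ι → ℝ) (γ c : ℕ → ℝ) (j l : ℕ) (δ : ℝ), j ≤ l → 0 ≤ δ → δ ≤ δ₀ →
        (∀ i, 0 ≤ γ i) → (∀ i, γ i ≤ 1) → (∀ i, 0 ≤ c i) → (∀ i, c i ≤ 1) →
        (∀ i x, 0 ≤ ϑ i x) → (∀ i, ∑ x, ϑ i x = 1) →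
        (∀ i, ϑ (i + 1) = (1 - γ i) • ϑ i + γ i • (c i • (ϑ (i + 1) ᵥ* G) + η i)) →
        (∀ i, j ≤ i → ‖ϑ (i + 1) - ϑ i‖ ≤ δ) →
        (∀ i, j ≤ i → i ≤ l → ‖∑ k ∈ Finset.Ico j i, γ k • η k‖ ≤ δ) →
        ‖ϑ l - θ‖ ≤ C * (Real.exp (-κ * ∑ i ∈ Finset.Ico j l, γ i) +
          δ * (1 + ∑ i ∈ Finset.Ico j l, γ i)) := by
  obtain ⟨m, hm, hmu⟩ := exists_pos_le h.u_pos
  have hu : ∀ x, 0 ≤ u x := fun x => (h.u_pos x).le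
  set U := ∑ x, u x with hUdef
  have hU : 0 < U := Finset.sum_pos (fun x _ => h.u_pos x) Finset.univ_nonempty
  set Γ := ∑ y, ∑ x, G x y with hΓdef
  have hΓ : 0 < Γ := Finset.sum_pos (fun y _ => Finset.sum_pos (fun x _ => h.G_pos x y)
    Finset.univ_nonempty) Finset.univ_nonempty
  set B := U * (1 + U) with hBdef
  have hB : 0 < B := by positivity
  set κ₀ := g * ε / (1 + g) with hκ₀
  have hκ₀pos : 0 < κ₀ := by
    have := h.g_pos; have := h.eps_pos; positivity
  set V := 4 * B / m with hVdef
  have hV : 0 < V := by positivity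
  set C₁ := (V + 1) * ((2 * Γ + 1) * (B + U)) / (m / 2) with hC₁
  have hC₁pos : 0 < C₁ := by positivity
  set K := Real.exp (κ₀ * Fintype.card ι / Γ) with hK
  have hKpos : 0 < K := Real.exp_pos _
  set C₂ := (1 + Fintype.card ι) / m with hC₂
  have hC₂pos : 0 < C₂ := by positivity
  refine ⟨C₂ * (2 * U * (K * V) + 2 * U * C₁ + B), κ₀ / Γ, min 1 (m / (2 * U)), by positivity,
    by positivity, by positivity, ?_⟩
  intro ϑ η γ c j l δ hjl hδ0 hδ hγ0 hγ1 hc0 hc1 hϑ0 hϑ1 hrec hinc hN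
  have hδ1 : δ ≤ 1 := hδ.trans (min_le_left _ _)
  have hδU : δ * U ≤ m / 2 := by
    have := hδ.trans (min_le_right _ _)
    rw [le_div_iff₀ (by positivity)] at this
    linarith
  have hϑn : ∀ i, ‖ϑ i‖ ≤ 1 := fun i => norm_le_one_of_mem_simplex (hϑ0 i) (hϑ1 i)
  set N : ℕ → ι → ℝ := fun i => ∑ k ∈ Finset.Ico j i, γ k • η k with hNdef
  set z : ℕ → ι → ℝ := fun i => ϑ i - N i with hz
  have hNδ : ∀ i, j ≤ i → i ≤ l → ‖N i‖ ≤ δ := hN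
  have hdevle : ∀ w, deviation θ u w ≤ B * ‖w‖ := deviation_le_norm hu h.left_nonneg h.left_sum
  have hϑu : ∀ i, m ≤ ϑ i ⬝ᵥ u := by
    intro i
    calc m = ∑ x, ϑ i x * m := by rw [← Finset.sum_mul, hϑ1, one_mul]
      _ ≤ _ := Finset.sum_le_sum fun x _ => mul_le_mul_of_nonneg_left (hmu x) (hϑ0 i x)
  have hϑU : ∀ i, ϑ i ⬝ᵥ u ≤ U := fun i =>
    (le_abs_self _).trans ((abs_dotProduct_le hu _).trans (mul_le_of_le_one_left hU.le (hϑn i)))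
  have hNu : ∀ i, j ≤ i → i ≤ l → |N i ⬝ᵥ u| ≤ m / 2 := fun i h1 h2 =>
    (abs_dotProduct_le hu _).trans
      ((mul_le_mul_of_nonneg_right (hNδ i h1 h2) hU.le).trans hδU)
  have hzu : ∀ i, j ≤ i → i ≤ l → m / 2 ≤ z i ⬝ᵥ u := by
    intro i h1 h2
    have := abs_le.1 (hNu i h1 h2)
    have h3 : z i ⬝ᵥ u = ϑ i ⬝ᵥ u - N i ⬝ᵥ u := sub_dotProduct _ _ _
    linarith [hϑu i]
  have hzn : ∀ i, j ≤ i → i ≤ l → ‖z i‖ ≤ 2 := by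
    intro i h1 h2
    have := norm_sub_le (ϑ i) (N i)
    have := hNδ i h1 h2
    have := hϑn i
    change ‖ϑ i - N i‖ ≤ 2
    linarith
  have hm2 : 0 < m / 2 := by positivity
  have hq : ∀ i, j ≤ i → i ≤ l → deviation θ u (z i) / (z i ⬝ᵥ u) ≤ V := by
    intro i h1 h2
    have h3 : deviation θ u (z i) ≤ 2 * B :=
      (hdevle _).trans (by nlinarith [hzn i h1 h2])
    calc _ ≤ 2 * B / (m / 2) := div_le_div₀ (by positivity) h3 hm2 (hzu i h1 h2)
      _ = V := by rw [hVdef]; field_simp; ring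
  have hq0 : ∀ i, j ≤ i → i ≤ l → 0 ≤ deviation θ u (z i) / (z i ⬝ᵥ u) := fun i h1 h2 =>
    div_nonneg (deviation_nonneg hu _) (hm2.le.trans (hzu i h1 h2))
  have hNsucc : ∀ i, j ≤ i → N (i + 1) = N i + γ i • η i := fun i h1 =>
    Finset.sum_Ico_succ_top h1 _
  have hstep : ∀ i, j ≤ i → i < l → deviation θ u (z (i + 1)) / (z (i + 1) ⬝ᵥ u) ≤
      (1 - κ₀ * (γ i * c i)) * (deviation θ u (z i) / (z i ⬝ᵥ u)) + C₁ * δ * γ i := by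
    intro i h1 h2
    set r : ι → ℝ := γ i • (c i • ((ϑ (i + 1) - ϑ i + N i) ᵥ* G) - N i) with hr
    have hzsucc : z (i + 1) = (1 - γ i) • z i + (γ i * c i) • (z i ᵥ* G) + r := by
      change ϑ (i + 1) - N (i + 1) = (1 - γ i) • (ϑ i - N i) + (γ i * c i) • ((ϑ i - N i) ᵥ* G) + r
      rw [hNsucc i h1, hr]
      nth_rewrite 1 [hrec i]
      simp only [Matrix.add_vecMul, Matrix.sub_vecMul]
      ext x
      simp only [Pi.add_apply, Pi.sub_apply, Pi.smul_apply, smul_eq_mul]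
      ring
    have hrn : ‖r‖ ≤ γ i * ((2 * Γ + 1) * δ) := by
      rw [hr, norm_smul, Real.norm_eq_abs, abs_of_nonneg (hγ0 i)]
      refine mul_le_mul_of_nonneg_left ?_ (hγ0 i)
      refine (norm_sub_le _ _).trans ?_
      have h3 := norm_vecMul_le (fun x y => (h.G_pos x y).le) (ϑ (i + 1) - ϑ i + N i)
      have h4 := norm_add_le (ϑ (i + 1) - ϑ i) (N i)
      have h5 := hNδ i h1 h2.le
      have h6 := hinc i h1
      have h7 : ‖c i • ((ϑ (i + 1) - ϑ i + N i) ᵥ* G)‖ ≤ ‖(ϑ (i + 1) - ϑ i + N i) ᵥ* G‖ := by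
        rw [norm_smul, Real.norm_eq_abs, abs_of_nonneg (hc0 i)]
        exact mul_le_of_le_one_left (norm_nonneg _) (hc1 i)
      have h8 : ‖ϑ (i + 1) - ϑ i + N i‖ * Γ ≤ 2 * δ * Γ :=
        mul_le_mul_of_nonneg_right (by linarith) hΓ.le
      linarith
    set e := γ i * ((2 * Γ + 1) * δ) * (B + U) with he
    have he0 : 0 ≤ e := by have := hγ0 i; positivity
    have hrn0 : 0 ≤ γ i * ((2 * Γ + 1) * δ) := by have := hγ0 i; positivity
    have hdr : deviation θ u r ≤ e := by
      refine (hdevle r).trans ?_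
      rw [he, mul_comm B]
      exact mul_le_mul hrn (by linarith) hB.le hrn0
    have hru : |r ⬝ᵥ u| ≤ e :=
      (abs_dotProduct_le hu r).trans (mul_le_mul hrn (by linarith) hU.le hrn0)
    have := h.quotient_step (s := 1 - γ i) (t := γ i * c i) (z := z i) (r := r) (e := e)
      (φ := m / 2) (V := V) (by linarith [hγ1 i]) (mul_nonneg (hγ0 i) (hc0 i))
      (by linarith [hγ0 i]) (mul_le_one₀ (hγ1 i) (hc0 i) (hc1 i)) he0 hdr hru hm2
      (hzu i h1 h2.le) (hzsucc ▸ hzu (i + 1) (by omega) h2) (hq i h1 h2.le)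
    rw [← hzsucc] at this
    refine this.trans_eq ?_
    rw [he, hC₁]
    ring
  have hfin := le_exp_of_recursion (v := fun i => deviation θ u (z i) / (z i ⬝ᵥ u))
    (t := fun i => γ i * c i) (b := fun i => C₁ * δ * γ i) hjl hκ₀pos.le
    (fun i => mul_nonneg (hγ0 i) (hc0 i)) (fun i => by have := hγ0 i; positivity) hq0 hstep
  set S := ∑ i ∈ Finset.Ico j l, γ i with hS
  have hS0 : 0 ≤ S := Finset.sum_nonneg fun i _ => hγ0 i
  have hclock : S ≤ Γ * ∑ i ∈ Finset.Ico j l, γ i * c i + Fintype.card ι := by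
    have h1 : ∀ i, γ i ≤ Γ * (γ i * c i) + ∑ x, (γ i • η i) x := by
      intro i
      have h2 : ∑ x, (ϑ (i + 1) ᵥ* G) x ≤ Γ := by
        refine Finset.sum_le_sum fun y _ => Finset.sum_le_sum fun x _ => ?_
        refine mul_le_of_le_one_left (h.G_pos x y).le ?_
        exact (hϑ1 (i + 1)) ▸
          Finset.single_le_sum (fun y _ => hϑ0 (i + 1) y) (Finset.mem_univ x)
      have h3 : ∑ x, ϑ (i + 1) x = (1 - γ i) * ∑ x, ϑ i x +
          (γ i * c i * ∑ x, (ϑ (i + 1) ᵥ* G) x + ∑ x, (γ i • η i) x) := by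
        rw [Finset.mul_sum, Finset.mul_sum, ← Finset.sum_add_distrib, ← Finset.sum_add_distrib]
        refine Finset.sum_congr rfl fun x _ => ?_
        nth_rewrite 1 [hrec i]
        simp only [Pi.add_apply, Pi.smul_apply, smul_eq_mul]
        ring
      rw [hϑ1, hϑ1] at h3
      have h4 := mul_le_mul_of_nonneg_left h2 (mul_nonneg (hγ0 i) (hc0 i))
      linarith
    have h5 : ∑ i ∈ Finset.Ico j l, ∑ x, (γ i • η i) x ≤ Fintype.card ι := by
      rw [Finset.sum_comm]
      calc ∑ x, ∑ i ∈ Finset.Ico j l, (γ i • η i) x = ∑ x, N l x :=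
            Finset.sum_congr rfl fun x _ => by rw [hNdef]; simp only [Finset.sum_apply]
        _ ≤ ∑ _x : ι, (1 : ℝ) := Finset.sum_le_sum fun x _ =>
            (le_abs_self _).trans ((norm_le_pi_norm (N l) x).trans ((hNδ l hjl le_rfl).trans hδ1))
        _ = _ := by simp
    have h6 := Finset.sum_le_sum fun i (_ : i ∈ Finset.Ico j l) => h1 i
    rw [Finset.sum_add_distrib, ← Finset.mul_sum] at h6
    linarith
  set T := ∑ i ∈ Finset.Ico j l, γ i * c i with hT
  have hexp : Real.exp (-κ₀ * T) ≤ K * Real.exp (-(κ₀ / Γ) * S) := by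
    rw [hK, ← Real.exp_add]
    refine Real.exp_le_exp.2 ?_
    have h1 : κ₀ / Γ * S ≤ κ₀ / Γ * (Γ * T + Fintype.card ι) :=
      mul_le_mul_of_nonneg_left hclock (by positivity)
    have h2 : κ₀ / Γ * (Γ * T + Fintype.card ι) = κ₀ * T + κ₀ * Fintype.card ι / Γ := by
      field_simp
    linarith
  set E := Real.exp (-(κ₀ / Γ) * S) with hE
  have hE0 : 0 < E := Real.exp_pos _
  have hql : deviation θ u (z l) / (z l ⬝ᵥ u) ≤ K * E * V + C₁ * δ * S := by
    refine hfin.trans (add_le_add ?_ (by rw [Finset.mul_sum]))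
    exact mul_le_mul hexp (hq j le_rfl hjl) (hq0 j le_rfl hjl) (by positivity)
  have hzlu : 0 < z l ⬝ᵥ u := hm2.trans_le (hzu l hjl le_rfl)
  have hzlU : z l ⬝ᵥ u ≤ 2 * U := by
    have h1 := abs_le.1 (hNu l hjl le_rfl)
    have h2 : m / 2 ≤ U := by linarith [hϑu l, hϑU l]
    have h3 : z l ⬝ᵥ u = ϑ l ⬝ᵥ u - N l ⬝ᵥ u := sub_dotProduct _ _ _
    linarith [hϑU l]
  have hdz : deviation θ u (z l) ≤ (K * E * V + C₁ * δ * S) * (2 * U) := by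
    rw [div_le_iff₀ hzlu] at hql
    exact hql.trans (mul_le_mul_of_nonneg_left hzlU (by positivity))
  have hdϑ : deviation θ u (ϑ l) ≤ (K * E * V + C₁ * δ * S) * (2 * U) + B * δ := by
    have h1 : ϑ l = z l + N l := (sub_add_cancel _ _).symm
    rw [h1]
    refine (deviation_add_le hu _ _).trans (add_le_add hdz ((hdevle _).trans ?_))
    exact mul_le_mul_of_nonneg_left (hNδ l hjl le_rfl) hB.le
  refine (h.norm_sub_le_deviation hm hmu (hϑ1 l)).trans ?_
  rw [mul_assoc]
  refine mul_le_mul_of_nonneg_left (hdϑ.trans ?_) hC₂pos.le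
  have t1 : 0 ≤ 2 * U * (K * V) * (δ * (1 + S)) := by positivity
  have t2 : 0 ≤ 2 * U * C₁ * (E + δ) := by positivity
  have t3 : 0 ≤ B * (E + δ * S) := by positivity
  nlinarith

end Lyapunov

section StepSizes

variable {γs : ℝ}

lemma gam_succ (γs : ℝ) (k : ℕ) : gam γs (k + 1) = γs / ((k : ℝ) + (⌊γs⌋₊ + 1 : ℕ)) := by
  rw [gam]; push_cast; congr 1; ring

lemma gam_succ_nonneg (hγs : 0 < γs) (k : ℕ) : 0 ≤ gam γs (k + 1) := by
  rw [gam_succ]; exact div_nonneg hγs.le (by positivity)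

lemma gam_succ_le_one (γs : ℝ) (k : ℕ) : gam γs (k + 1) ≤ 1 := by
  rw [gam_succ, div_le_one (by positivity)]
  push_cast
  linarith [Nat.lt_floor_add_one γs, (Nat.cast_nonneg k : (0 : ℝ) ≤ k)]

lemma gam_succ_antitone (h : 0 < γs) : Antitone fun k => gam γs (k + 1) := by
  intro i k hik
  simp only [gam_succ]
  have : (i : ℝ) ≤ k := Nat.cast_le.2 hik
  gcongr

lemma gam_succ_le (h : 0 < γs) (k : ℕ) : gam γs (k + 1) ≤ γs / ((k : ℝ) + 1) := by
  rw [gam_succ]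
  push_cast
  gcongr
  linarith [(Nat.cast_nonneg ⌊γs⌋₊ : (0 : ℝ) ≤ ⌊γs⌋₊)]

lemma one_div_add_one_le_log {x : ℝ} (hx : 0 < x) :
    1 / (x + 1) ≤ Real.log (x + 1) - Real.log x := by
  have h := Real.log_le_sub_one_of_pos (x := x / (x + 1)) (by positivity)
  rw [Real.log_div hx.ne' (by positivity)] at h
  have : x / (x + 1) - 1 = -(1 / (x + 1)) := by field_simp; ring
  linarith

lemma log_sub_log_le_one_div {x : ℝ} (hx : 0 < x) :
    Real.log (x + 1) - Real.log x ≤ 1 / x := by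
  have h := Real.log_le_sub_one_of_pos (x := (x + 1) / x) (by positivity)
  rw [Real.log_div (by positivity) hx.ne'] at h
  have : (x + 1) / x - 1 = 1 / x := by field_simp; ring
  linarith

lemma le_sum_gam (h : 0 < γs) {j l : ℕ} (hjl : j ≤ l) :
    γs * (Real.log (l + (⌊γs⌋₊ + 1 : ℕ)) - Real.log (j + (⌊γs⌋₊ + 1 : ℕ))) ≤
      ∑ i ∈ Finset.Ico j l, gam γs (i + 1) := by
  induction l, hjl using Nat.le_induction with
  | base => simp
  | succ l hjl ih =>
    rw [Finset.sum_Ico_succ_top hjl, gam_succ]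
    have := log_sub_log_le_one_div (x := (l : ℝ) + (⌊γs⌋₊ + 1 : ℕ)) (by positivity)
    have h2 := mul_le_mul_of_nonneg_left this h.le
    rw [mul_one_div] at h2
    have h3 : ((l + 1 : ℕ) : ℝ) + (⌊γs⌋₊ + 1 : ℕ) = (l : ℝ) + (⌊γs⌋₊ + 1 : ℕ) + 1 := by
      push_cast; ring
    rw [h3]
    linarith

lemma sum_gam_le (h : 0 < γs) {j l : ℕ} (hj : 1 ≤ j) (hjl : j ≤ l) :
    ∑ i ∈ Finset.Ico j l, gam γs (i + 1) ≤ γs * (Real.log l - Real.log j) := by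
  induction l, hjl using Nat.le_induction with
  | base => simp
  | succ l hjl ih =>
    rw [Finset.sum_Ico_succ_top hjl]
    have hl : (0 : ℝ) < l := Nat.cast_pos.2 (by omega)
    have h2 := mul_le_mul_of_nonneg_left (one_div_add_one_le_log hl) h.le
    rw [mul_one_div] at h2
    have := gam_succ_le h l
    push_cast
    linarith

lemma sum_gam_sq_le (h : 0 < γs) {j l : ℕ} (hj : 1 ≤ j) (hjl : j ≤ l) :
    ∑ i ∈ Finset.Ico j l, gam γs (i + 1) ^ 2 ≤ γs ^ 2 * (1 / j - 1 / l) := by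
  induction l, hjl using Nat.le_induction with
  | base => simp
  | succ l hjl ih =>
    rw [Finset.sum_Ico_succ_top hjl]
    have hl : (0 : ℝ) < l := Nat.cast_pos.2 (by omega)
    have h1 : gam γs (l + 1) ^ 2 ≤ (γs / ((l : ℝ) + 1)) ^ 2 :=
      pow_le_pow_left₀ (gam_succ_nonneg h l) (gam_succ_le h l) 2
    have h2 : (γs / ((l : ℝ) + 1)) ^ 2 ≤ γs ^ 2 * (1 / l - 1 / (l + 1)) := by
      have h3 : (1 : ℝ) / l - 1 / (l + 1) = 1 / (l * (l + 1)) := by field_simp; ring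
      rw [div_pow, h3, mul_one_div]
      gcongr
      nlinarith
    push_cast
    linarith

/-- Abel summation bound. -/
lemma norm_sum_smul_sub_le {E : Type*} [NormedAddCommGroup E] [NormedSpace ℝ E] {γ : ℕ → ℝ}
    (hγ : Antitone γ) (hγ0 : ∀ k, 0 ≤ γ k) {v : ℕ → E} (hv : ∀ k, ‖v k‖ ≤ 1) {j l : ℕ}
    (hjl : j ≤ l) : ‖∑ k ∈ Finset.Ico j l, γ k • (v (k + 1) - v k)‖ ≤ 2 * γ j := by
  have key : ‖∑ k ∈ Finset.Ico j l, γ k • (v (k + 1) - v k) - γ l • v l‖ ≤ 2 * γ j - γ l := by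
    induction l, hjl using Nat.le_induction with
    | base =>
      rw [Finset.Ico_self, Finset.sum_empty, zero_sub, norm_neg, norm_smul, Real.norm_eq_abs,
        abs_of_nonneg (hγ0 j)]
      nlinarith [hγ0 j, hv j]
    | succ l hjl ih =>
      have h1 : ∑ k ∈ Finset.Ico j (l + 1), γ k • (v (k + 1) - v k) - γ (l + 1) • v (l + 1) =
          (∑ k ∈ Finset.Ico j l, γ k • (v (k + 1) - v k) - γ l • v l) +
            (γ l - γ (l + 1)) • v (l + 1) := by
        rw [Finset.sum_Ico_succ_top hjl]
        module
      have h2 : ‖(γ l - γ (l + 1)) • v (l + 1)‖ ≤ γ l - γ (l + 1) := by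
        have h3 : 0 ≤ γ l - γ (l + 1) := sub_nonneg.2 (hγ (Nat.le_succ l))
        rw [norm_smul, Real.norm_eq_abs, abs_of_nonneg h3]
        exact mul_le_of_le_one_right h3 (hv _)
      rw [h1]
      refine (norm_add_le _ _).trans ?_
      linarith
  have h1 : ‖γ l • v l‖ ≤ γ l := by
    rw [norm_smul, Real.norm_eq_abs, abs_of_nonneg (hγ0 l)]
    exact mul_le_of_le_one_right (hγ0 l) (hv l)
  have h2 := norm_sub_norm_le (∑ k ∈ Finset.Ico j l, γ k • (v (k + 1) - v k)) (γ l • v l)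
  linarith

end StepSizes

section Pathwise

variable {d : ℕ} {P : Matrix (Fin (d + 1)) (Fin (d + 1)) ℝ} {pi : (Fin d → ℝ) → Fin d → ℝ}
  {θs : Fin d → ℝ}

lemma Setup.killed_add_rowsum (hS : Setup d P pi) (x : Fin d) :
    P x.succ 0 + ∑ y : Fin d, P x.succ y.succ = 1 := by
  rw [← Fin.sum_univ_succ, hS.P_rowsum]

lemma Setup.killed_le_one (hS : Setup d P pi) (x : Fin d) : P x.succ 0 ≤ 1 := by
  have := hS.killed_add_rowsum x
  have : 0 ≤ ∑ y : Fin d, P x.succ y.succ := Finset.sum_nonneg fun y _ => hS.P_nonneg _ _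
  linarith

lemma sum_mul_Kmat (P : Matrix (Fin (d + 1)) (Fin (d + 1)) ℝ) (w ν : Fin d → ℝ) (y : Fin d) :
    ∑ x, w x * Kmat P ν x y =
      (w ᵥ* Matrix.of fun x y : Fin d => P x.succ y.succ) y +
        (w ⬝ᵥ fun x => P x.succ 0) * ν y := by
  simp only [Kmat, Matrix.of_apply, mul_add, Finset.sum_add_distrib, Matrix.vecMul, dotProduct,
    Finset.sum_mul, mul_assoc]

/-- The Green matrix `(1 - Q)⁻¹` of the killed chain, with its Perron data; its left Perron
eigenvector is the quasi-stationary distribution. -/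
lemma Setup.exists_perronData (hd : 0 < d) (hS : Setup d P pi) (hQSD : IsQSD d P pi θs) :
    ∃ G u g ε, (1 - Matrix.of fun x y : Fin d => P x.succ y.succ) * G = 1 ∧
      PerronData G θs u g ε := by
  have : Nonempty (Fin d) := ⟨⟨0, hd⟩⟩
  set Q : Matrix (Fin d) (Fin d) ℝ := Matrix.of fun x y : Fin d => P x.succ y.succ with hQ
  obtain ⟨G, hG1, hGpos⟩ := exists_pos_inverse (Q := Q) (fun x y => hS.P_nonneg _ _)
    (fun x => by
      have := hS.killed_add_rowsum x
      have := hS.P_nonneg x.succ 0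
      simp only [hQ, Matrix.of_apply]; linarith) hS.P_irred
    (by
      obtain ⟨x, hx⟩ := hS.P_killed
      have := hS.killed_add_rowsum x
      exact ⟨x, by simp only [hQ, Matrix.of_apply]; linarith⟩)
  set r := θs ⬝ᵥ fun x => P x.succ 0 with hr
  have hr0 : 0 ≤ r := Finset.sum_nonneg fun x _ => mul_nonneg (hQSD.mem.1 x) (hS.P_nonneg _ _)
  have hfix : θs ᵥ* (1 - Q) = r • θs := by
    rw [Matrix.vecMul_sub, Matrix.vecMul_one]
    ext y
    have := hS.pi_invariant θs hQSD.mem y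
    rw [hQSD.fixed, sum_mul_Kmat] at this
    simp only [Pi.sub_apply, Pi.smul_apply, smul_eq_mul]
    linarith
  have hθ : θs = r • (θs ᵥ* G) := by
    rw [← Matrix.smul_vecMul, ← hfix, Matrix.vecMul_vecMul, hG1, Matrix.vecMul_one]
  have hrne : r ≠ 0 := by
    intro h0
    rw [h0, zero_smul] at hθ
    have := hQSD.mem.2
    simp [hθ] at this
  obtain ⟨u, ε, h⟩ := QSDPaper.exists_perronData hGpos hQSD.mem.1 hQSD.mem.2
    (inv_pos.2 (hr0.lt_of_ne' hrne)) (by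
      rw [eq_inv_smul_iff₀ hrne]; exact hθ.symm)
  exact ⟨G, u, r⁻¹, ε, hG1, h⟩

/-- Deterministic convergence rate: along any trajectory whose accumulated martingale noise
between times `j` and `l` is at most `δ`, the occupation measure at time `l` is close to the
quasi-stationary distribution. -/
lemma Setup.exists_norm_sub_le (hd : 0 < d) (hS : Setup d P pi) (hQSD : IsQSD d P pi θs)
    {γs : ℝ} (hγ : 0 < γs) :
    ∃ C κ δ₀ : ℝ, 0 < C ∧ 0 < κ ∧ 0 < δ₀ ∧
      ∀ (ϑ ν : ℕ → Fin d → ℝ) (j l : ℕ) (δ : ℝ), 1 ≤ j → j ≤ l → δ ≤ δ₀ → γs / j ≤ δ →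
        (∀ k, ϑ k ∈ simplex d) → (∀ k, ν k ∈ simplex d) →
        (∀ k, ϑ (k + 1) = (1 - gam γs (k + 1)) • ϑ k + gam γs (k + 1) • ν (k + 1)) →
        (∀ i, j ≤ i → i ≤ l → ∀ x, |∑ k ∈ Finset.Ico j i, gam γs (k + 1) *
          (ν (k + 2) x - ∑ z, ν (k + 1) z * Kmat P (ϑ (k + 1)) z x)| ≤ δ) →
        ‖ϑ l - θs‖ ≤ C * (((j + (⌊γs⌋₊ + 1 : ℕ)) / (l + (⌊γs⌋₊ + 1 : ℕ)) : ℝ) ^ κ +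
          δ * (1 + γs * Real.log l)) := by
  have : Nonempty (Fin d) := ⟨⟨0, hd⟩⟩
  obtain ⟨G, u, g, ε, hG, h⟩ := hS.exists_perronData hd hQSD
  obtain ⟨C, κ, δ₀, hC, hκ, hδ₀, H⟩ := h.exists_norm_sub_le
  set Q : Matrix (Fin d) (Fin d) ℝ := Matrix.of fun x y : Fin d => P x.succ y.succ with hQ
  set Γ := ∑ y, ∑ x, G x y with hΓdef
  have hΓ : 0 ≤ Γ := Finset.sum_nonneg fun y _ => Finset.sum_nonneg fun x _ => (h.G_pos x y).le
  set A := 3 * Γ + 2 with hA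
  have hApos : 0 < A := by positivity
  refine ⟨C * (1 + A), κ * γs, δ₀ / A, by positivity, by positivity, by positivity, ?_⟩
  intro ϑ ν j l δ hj hjl hδ hγδ hϑ hν hrec hnoise
  have hj0 : (0 : ℝ) < j := Nat.cast_pos.2 hj
  have hl0 : (0 : ℝ) < l := Nat.cast_pos.2 (hj.trans hjl)
  have hδ0 : 0 ≤ δ := (by positivity : 0 ≤ γs / j).trans hγδ
  have hνn : ∀ k, ‖ν k‖ ≤ 1 := fun k => norm_le_one_of_mem_simplex (hν k).1 (hν k).2
  have hϑn : ∀ k, ‖ϑ k‖ ≤ 1 := fun k => norm_le_one_of_mem_simplex (hϑ k).1 (hϑ k).2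
  have hγj : ∀ i, j ≤ i → gam γs (i + 1) ≤ δ := by
    intro i hi
    refine (gam_succ_le hγ i).trans (le_trans ?_ hγδ)
    have : (j : ℝ) ≤ i := Nat.cast_le.2 hi
    gcongr
    linarith
  set c : ℕ → ℝ := fun k => ν (k + 1) ⬝ᵥ fun x => P x.succ 0 with hc
  set D : ℕ → Fin d → ℝ := fun k x =>
    ν (k + 2) x - ∑ z, ν (k + 1) z * Kmat P (ϑ (k + 1)) z x with hD
  set η : ℕ → Fin d → ℝ := fun k => ν (k + 1) - c k • (ϑ (k + 1) ᵥ* G) with hη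
  have hηD : ∀ k, η k = (D k - (ν (k + 2) - ν (k + 1))) ᵥ* G := by
    intro k
    have h1 : D k - (ν (k + 2) - ν (k + 1)) = ν (k + 1) ᵥ* (1 - Q) - c k • ϑ (k + 1) := by
      ext x
      simp only [hD, hc, sum_mul_Kmat, Matrix.vecMul_sub, Matrix.vecMul_one, Pi.sub_apply,
        Pi.smul_apply, smul_eq_mul]
      ring
    rw [h1, Matrix.sub_vecMul, Matrix.vecMul_vecMul, hG, Matrix.vecMul_one, Matrix.smul_vecMul]
  have key := H ϑ η (fun k => gam γs (k + 1)) c j l (A * δ) hjl (by positivity)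
    (by rw [le_div_iff₀ hApos] at hδ; linarith) (gam_succ_nonneg hγ) (gam_succ_le_one γs)
    (fun k => Finset.sum_nonneg fun x _ => mul_nonneg ((hν _).1 x) (hS.P_nonneg _ _))
    (fun k => by
      rw [← (hν (k + 1)).2]
      exact Finset.sum_le_sum fun x _ =>
        mul_le_of_le_one_right ((hν _).1 x) (hS.killed_le_one x))
    (fun k => (hϑ k).1) (fun k => (hϑ k).2)
    (fun k => by rw [hη]; simp only [add_sub_cancel]; exact hrec k)
    (fun i hi => by
      have h1 : ϑ (i + 1) - ϑ i = gam γs (i + 1) • (ν (i + 1) - ϑ i) := by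
        rw [hrec i]; module
      rw [h1, norm_smul, Real.norm_eq_abs, abs_of_nonneg (gam_succ_nonneg hγ i)]
      have h2 : ‖ν (i + 1) - ϑ i‖ ≤ 2 := by
        linarith [norm_sub_le (ν (i + 1)) (ϑ i), hνn (i + 1), hϑn i]
      calc gam γs (i + 1) * ‖ν (i + 1) - ϑ i‖ ≤ δ * 2 :=
            mul_le_mul (hγj i hi) h2 (norm_nonneg _) hδ0
        _ ≤ A * δ := by rw [hA]; nlinarith [mul_nonneg hΓ hδ0])
    (fun i hji hil => by
      have h1 : ∑ k ∈ Finset.Ico j i, gam γs (k + 1) • η k =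
          (∑ k ∈ Finset.Ico j i, gam γs (k + 1) • D k -
            ∑ k ∈ Finset.Ico j i, gam γs (k + 1) • (ν (k + 2) - ν (k + 1))) ᵥ* G := by
        rw [← Finset.sum_sub_distrib, Matrix.sum_vecMul]
        refine Finset.sum_congr rfl fun k _ => ?_
        rw [hηD, ← smul_sub, Matrix.smul_vecMul]
      have h2 : ‖∑ k ∈ Finset.Ico j i, gam γs (k + 1) • D k‖ ≤ δ := by
        refine (pi_norm_le_iff_of_nonneg hδ0).2 fun x => ?_
        rw [Finset.sum_apply]
        exact hnoise i hji hil x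
      have h3 := norm_sum_smul_sub_le (gam_succ_antitone hγ) (gam_succ_nonneg hγ)
        (v := fun k => ν (k + 1)) (fun k => hνn _) hji
      have h4 := hγj j le_rfl
      rw [h1]
      refine (norm_vecMul_le (fun x y => (h.G_pos x y).le) _).trans ?_
      calc _ ≤ (δ + 2 * δ) * Γ := by
            refine mul_le_mul_of_nonneg_right ((norm_sub_le _ _).trans (add_le_add h2 ?_)) hΓ
            exact h3.trans (by linarith)
        _ ≤ A * δ := by rw [hA]; nlinarith)
  refine key.trans ?_
  rw [mul_assoc C (1 + A)]
  refine mul_le_mul_of_nonneg_left ?_ hC.le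
  set M : ℝ := ((⌊γs⌋₊ + 1 : ℕ) : ℝ) with hM
  have hM0 : 0 ≤ M := Nat.cast_nonneg _
  have hexp : Real.exp (-κ * ∑ i ∈ Finset.Ico j l, gam γs (i + 1)) ≤
      ((j + M) / (l + M)) ^ (κ * γs) := by
    rw [Real.rpow_def_of_pos (by positivity), Real.log_div (by positivity) (by positivity)]
    refine Real.exp_le_exp.2 ?_
    have := mul_le_mul_of_nonneg_left (le_sum_gam hγ hjl) hκ.le
    linarith
  have hlogj : 0 ≤ Real.log j := Real.log_natCast_nonneg j
  have hlogl : 0 ≤ Real.log l := Real.log_natCast_nonneg l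
  have hS : ∑ i ∈ Finset.Ico j l, gam γs (i + 1) ≤ γs * Real.log l :=
    (sum_gam_le hγ hj hjl).trans (mul_le_mul_of_nonneg_left (by linarith) hγ.le)
  have hE0 : 0 ≤ ((j + M) / (l + M)) ^ (κ * γs) := by positivity
  have h1 : A * δ * (1 + ∑ i ∈ Finset.Ico j l, gam γs (i + 1)) ≤
      A * δ * (1 + γs * Real.log l) :=
    mul_le_mul_of_nonneg_left (by linarith) (by positivity)
  have h2 : 0 ≤ δ * (1 + γs * Real.log l) := by positivity
  nlinarith [mul_nonneg hApos.le hE0]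

end Pathwise

section Azuma

lemma exp_le_add_exp_sq (x : ℝ) : Real.exp x ≤ x + Real.exp (x ^ 2) := by
  have h2 := Real.add_one_le_exp (x ^ 2)
  rcases le_or_gt |x| 1 with h | h
  · have h1 := (abs_le.1 (Real.abs_exp_sub_one_sub_id_le h)).2
    linarith
  · rcases lt_or_ge x 0 with h0 | h0
    · rw [abs_of_neg h0] at h
      have : Real.exp x ≤ 1 := Real.exp_le_one_iff.2 h0.le
      nlinarith
    · rw [abs_of_nonneg h0] at h
      have : Real.exp x ≤ Real.exp (x ^ 2) := Real.exp_le_exp.2 (by nlinarith)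
      linarith

variable {Ω : Type*} {m0 : MeasurableSpace Ω} {μ : Measure Ω} [IsProbabilityMeasure μ]

/-- A bounded `m`-measurable function is orthogonal to a bounded function with vanishing
conditional expectation given `m`. -/
lemma integral_mul_eq_zero_of_condExp_eq_zero {m : MeasurableSpace Ω} (hm : m ≤ m0) {Z D : Ω → ℝ}
    (hZ : Measurable[m] Z) {c : ℝ} (hZc : ∀ ω, |Z ω| ≤ c) (hD : Integrable D μ)
    (h0 : μ[D | m] =ᵐ[μ] 0) : ∫ ω, Z ω * D ω ∂μ = 0 := by
  have hZm : StronglyMeasurable[m] Z := hZ.stronglyMeasurable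
  have hZD : Integrable (Z * D) μ :=
    hD.bdd_mul (c := c) (hZ.mono hm le_rfl).aestronglyMeasurable (ae_of_all _ hZc)
  calc ∫ ω, Z ω * D ω ∂μ = ∫ ω, (μ[Z * D | m]) ω ∂μ := (integral_condExp hm).symm
    _ = ∫ _ω, (0 : ℝ) ∂μ := by
        refine integral_congr_ae ?_
        filter_upwards [condExp_mul_of_stronglyMeasurable_left hZm hZD hD, h0] with ω h1 h2
        rw [h1, Pi.mul_apply, h2, Pi.zero_apply, mul_zero]
    _ = 0 := by simp

variable {ℱ : ℕ → MeasurableSpace Ω} {D : ℕ → Ω → ℝ} {b : ℕ → ℝ}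

lemma measurable_sum_Ico (hmono : Monotone ℱ) (hD : ∀ k, Measurable[ℱ (k + 1)] (D k)) (j l : ℕ) :
    Measurable[ℱ l] fun ω => ∑ k ∈ Finset.Ico j l, D k ω :=
  Finset.measurable_fun_sum _ fun k hk =>
    (hD k).mono (hmono (Nat.succ_le_of_lt (Finset.mem_Ico.1 hk).2)) le_rfl

lemma abs_sum_Ico_le (hb : ∀ k ω, |D k ω| ≤ b k) (j l : ℕ) (ω : Ω) :
    |∑ k ∈ Finset.Ico j l, D k ω| ≤ ∑ k ∈ Finset.Ico j l, b k :=
  (Finset.abs_sum_le_sum_abs _ _).trans (Finset.sum_le_sum fun k _ => hb k ω)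

/-- Azuma's exponential moment bound for bounded martingale differences. -/
lemma mgf_sum_Ico_le (hle : ∀ k, ℱ k ≤ m0) (hmono : Monotone ℱ)
    (hD : ∀ k, Measurable[ℱ (k + 1)] (D k)) (hb : ∀ k ω, |D k ω| ≤ b k)
    (hc : ∀ k, μ[D k | ℱ k] =ᵐ[μ] 0) (t : ℝ) {j l : ℕ} (hjl : j ≤ l) :
    mgf (fun ω => ∑ k ∈ Finset.Ico j l, D k ω) μ t ≤
      Real.exp (t ^ 2 * ∑ k ∈ Finset.Ico j l, b k ^ 2) := by
  induction l, hjl using Nat.le_induction with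
  | base => simp
  | succ l hjl ih =>
    set S : Ω → ℝ := fun ω => ∑ k ∈ Finset.Ico j l, D k ω with hS
    set Z : Ω → ℝ := fun ω => Real.exp (t * S ω) with hZ
    have hSm : Measurable[ℱ l] S := measurable_sum_Ico hmono hD j l
    have hZm : Measurable[ℱ l] Z :=
      Real.measurable_exp.comp (hSm.const_mul t)
    have hZb : ∀ ω, |Z ω| ≤ Real.exp (|t| * ∑ k ∈ Finset.Ico j l, b k) := by
      intro ω
      rw [hZ, Real.abs_exp]
      refine Real.exp_le_exp.2 ((le_abs_self _).trans ?_)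
      rw [abs_mul]
      exact mul_le_mul_of_nonneg_left (abs_sum_Ico_le hb j l ω) (abs_nonneg t)
    have hDm : Measurable[m0] (D l) := (hD l).mono (hle _) le_rfl
    have hDi : Integrable (D l) μ :=
      Integrable.of_bound hDm.aestronglyMeasurable (b l) (ae_of_all _ (hb l))
    have hZi : Integrable Z μ :=
      Integrable.of_bound (hZm.mono (hle _) le_rfl).aestronglyMeasurable _ (ae_of_all _ hZb)
    have hZDi : Integrable (fun ω => Z ω * D l ω) μ :=
      hDi.bdd_mul (hZm.mono (hle _) le_rfl).aestronglyMeasurable (ae_of_all _ hZb)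
    have hpt : ∀ ω, Real.exp (t * ∑ k ∈ Finset.Ico j (l + 1), D k ω) ≤
        t * (Z ω * D l ω) + Real.exp (t ^ 2 * b l ^ 2) * Z ω := by
      intro ω
      rw [Finset.sum_Ico_succ_top hjl, mul_add, Real.exp_add]
      have h1 := exp_le_add_exp_sq (t * D l ω)
      have h2 : Real.exp ((t * D l ω) ^ 2) ≤ Real.exp (t ^ 2 * b l ^ 2) := by
        refine Real.exp_le_exp.2 ?_
        rw [mul_pow]
        refine mul_le_mul_of_nonneg_left ?_ (sq_nonneg t)
        exact sq_le_sq' (abs_le.1 (hb l ω)).1 (abs_le.1 (hb l ω)).2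
      have h3 : 0 ≤ Z ω := (Real.exp_pos _).le
      calc Z ω * Real.exp (t * D l ω) ≤ Z ω * (t * D l ω + Real.exp (t ^ 2 * b l ^ 2)) :=
            mul_le_mul_of_nonneg_left (h1.trans (by linarith)) h3
        _ = _ := by ring
    calc mgf (fun ω => ∑ k ∈ Finset.Ico j (l + 1), D k ω) μ t
        ≤ ∫ ω, (t * (Z ω * D l ω) + Real.exp (t ^ 2 * b l ^ 2) * Z ω) ∂μ :=
          integral_mono_of_nonneg (ae_of_all _ fun ω => (Real.exp_pos _).le)
            ((hZDi.const_mul t).add (hZi.const_mul _)) (ae_of_all _ hpt)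
      _ = Real.exp (t ^ 2 * b l ^ 2) * mgf S μ t := by
          rw [integral_add (hZDi.const_mul t) (hZi.const_mul _), integral_const_mul,
            integral_const_mul,
            integral_mul_eq_zero_of_condExp_eq_zero (hle l) hZm hZb hDi (hc l), mul_zero, zero_add]
          rfl
      _ ≤ Real.exp (t ^ 2 * b l ^ 2) * Real.exp (t ^ 2 * ∑ k ∈ Finset.Ico j l, b k ^ 2) :=
          mul_le_mul_of_nonneg_left ih (Real.exp_pos _).le
      _ = _ := by
          rw [← Real.exp_add, Finset.sum_Ico_succ_top hjl]
          ring_nf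

lemma measure_sum_Ico_ge_le (hle : ∀ k, ℱ k ≤ m0) (hmono : Monotone ℱ)
    (hD : ∀ k, Measurable[ℱ (k + 1)] (D k)) (hb : ∀ k ω, |D k ω| ≤ b k)
    (hc : ∀ k, μ[D k | ℱ k] =ᵐ[μ] 0) {j l : ℕ} (hjl : j ≤ l) {B δ : ℝ} (hB : 0 < B)
    (hbB : ∑ k ∈ Finset.Ico j l, b k ^ 2 ≤ B) (hδ : 0 ≤ δ) :
    μ.real {ω | δ ≤ ∑ k ∈ Finset.Ico j l, D k ω} ≤ Real.exp (-(δ ^ 2 / (4 * B))) := by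
  set t := δ / (2 * B) with ht
  have hint : Integrable (fun ω => Real.exp (t * ∑ k ∈ Finset.Ico j l, D k ω)) μ := by
    refine Integrable.of_bound ?_ (Real.exp (|t| * ∑ k ∈ Finset.Ico j l, b k))
      (ae_of_all _ fun ω => ?_)
    · have h1 := (measurable_sum_Ico hmono hD j l).mono (hle l) le_rfl
      exact (Real.measurable_exp.comp (h1.const_mul t)).aestronglyMeasurable
    · rw [Real.norm_eq_abs, Real.abs_exp]
      refine Real.exp_le_exp.2 ((le_abs_self _).trans ?_)
      rw [abs_mul]
      exact mul_le_mul_of_nonneg_left (abs_sum_Ico_le hb j l ω) (abs_nonneg t)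
  have h1 := measure_ge_le_exp_mul_mgf (μ := μ) δ (by positivity : 0 ≤ t) hint
  refine h1.trans ?_
  refine (mul_le_mul_of_nonneg_left (mgf_sum_Ico_le hle hmono hD hb hc t hjl)
    (Real.exp_pos _).le).trans ?_
  rw [← Real.exp_add]
  refine Real.exp_le_exp.2 ?_
  have h2 := mul_le_mul_of_nonneg_left hbB (sq_nonneg t)
  have h3 : -t * δ + t ^ 2 * B = -(δ ^ 2 / (4 * B)) := by
    rw [ht]; field_simp; ring
  linarith

/-- Azuma's inequality. -/
lemma measure_abs_sum_Ico_ge_le (hle : ∀ k, ℱ k ≤ m0) (hmono : Monotone ℱ)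
    (hD : ∀ k, Measurable[ℱ (k + 1)] (D k)) (hb : ∀ k ω, |D k ω| ≤ b k)
    (hc : ∀ k, μ[D k | ℱ k] =ᵐ[μ] 0) {j l : ℕ} (hjl : j ≤ l) {B δ : ℝ} (hB : 0 < B)
    (hbB : ∑ k ∈ Finset.Ico j l, b k ^ 2 ≤ B) (hδ : 0 ≤ δ) :
    μ.real {ω | δ ≤ |∑ k ∈ Finset.Ico j l, D k ω|} ≤ 2 * Real.exp (-(δ ^ 2 / (4 * B))) := by
  have h1 := measure_sum_Ico_ge_le hle hmono hD hb hc hjl hB hbB hδ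
  have h2 := measure_sum_Ico_ge_le (D := fun k ω => -D k ω) hle hmono (fun k => (hD k).neg)
    (fun k ω => by rw [abs_neg]; exact hb k ω)
    (fun k => by
      have h3 := condExp_neg (μ := μ) (D k) (ℱ k)
      filter_upwards [h3, hc k] with ω h4 h5
      change (μ[-D k | ℱ k]) ω = 0
      rw [h4, Pi.neg_apply, h5, Pi.zero_apply, neg_zero]) hjl hB hbB hδ
  have hsub : {ω | δ ≤ |∑ k ∈ Finset.Ico j l, D k ω|} ⊆
      {ω | δ ≤ ∑ k ∈ Finset.Ico j l, D k ω} ∪ {ω | δ ≤ ∑ k ∈ Finset.Ico j l, -D k ω} := by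
    intro ω hω
    rcases le_abs.1 (show δ ≤ |∑ k ∈ Finset.Ico j l, D k ω| from hω) with h | h
    · exact Or.inl h
    · exact Or.inr (by simpa only [Set.mem_ofPred_eq, Finset.sum_neg_distrib] using h)
  have h3 := (measureReal_mono (μ := μ) hsub).trans (measureReal_union_le _ _)
  linarith

end Azuma

section Algorithm

lemma Setup.Kmat_rowsum {d : ℕ} {P : Matrix (Fin (d + 1)) (Fin (d + 1)) ℝ}
    {pi : (Fin d → ℝ) → Fin d → ℝ} (hS : Setup d P pi) {ν : Fin d → ℝ} (hν : ν ∈ simplex d)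
    (x : Fin d) : ∑ y, Kmat P ν x y = 1 := by
  simp only [Kmat, Matrix.of_apply, Finset.sum_add_distrib, ← Finset.mul_sum, hν.2, mul_one]
  rw [add_comm, hS.killed_add_rowsum]

lemma Setup.Kmat_nonneg {d : ℕ} {P : Matrix (Fin (d + 1)) (Fin (d + 1)) ℝ}
    {pi : (Fin d → ℝ) → Fin d → ℝ} (hS : Setup d P pi) {ν : Fin d → ℝ} (hν : ν ∈ simplex d)
    (x y : Fin d) : 0 ≤ Kmat P ν x y :=
  add_nonneg (hS.P_nonneg _ _) (mul_nonneg (hS.P_nonneg _ _) (hν.1 y))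

lemma Setup.Kmat_le_one {d : ℕ} {P : Matrix (Fin (d + 1)) (Fin (d + 1)) ℝ}
    {pi : (Fin d → ℝ) → Fin d → ℝ} (hS : Setup d P pi) {ν : Fin d → ℝ} (hν : ν ∈ simplex d)
    (x y : Fin d) : Kmat P ν x y ≤ 1 :=
  hS.Kmat_rowsum hν x ▸
    Finset.single_le_sum (fun z _ => hS.Kmat_nonneg hν x z) (Finset.mem_univ y)

variable {d : ℕ} {P : Matrix (Fin (d + 1)) (Fin (d + 1)) ℝ} {pi : (Fin d → ℝ) → Fin d → ℝ}
  {γs : ℝ} {a : ℕ → ℕ} {x0 : Fin d} {Ω : Type} [m0 : MeasurableSpace Ω] {μ : Measure Ω}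

namespace AlgorithmI

/-- The empirical measure of the `a n` particles at time `k`. -/
def emp (A : AlgorithmI d P γs a x0 Ω μ) (n k : ℕ) (ω : Ω) (x : Fin d) : ℝ :=
  (a n : ℝ)⁻¹ * ∑ i ∈ Finset.range (a n), if A.X n k i ω = x then (1 : ℝ) else 0

variable (A : AlgorithmI d P γs a x0 Ω μ)

lemma sum_emp_mul (n k : ℕ) (ω : Ω) (f : Fin d → ℝ) :
    ∑ x, A.emp n k ω x * f x = (a n : ℝ)⁻¹ * ∑ i ∈ Finset.range (a n), f (A.X n k i ω) := by
  simp only [emp, mul_assoc, ← Finset.mul_sum, Finset.sum_mul]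
  rw [Finset.sum_comm]
  simp

lemma emp_mem_simplex (ha : ∀ n, 0 < a n) (n k : ℕ) (ω : Ω) : A.emp n k ω ∈ simplex d := by
  refine ⟨fun x => mul_nonneg (by positivity)
    (Finset.sum_nonneg fun i _ => by split_ifs <;> norm_num), ?_⟩
  have h := A.sum_emp_mul n k ω fun _ => 1
  have h0 : (a n : ℝ) ≠ 0 := Nat.cast_ne_zero.2 (ha n).ne'
  simpa [h0] using h

lemma theta_succ (n k : ℕ) (ω : Ω) : A.theta n (k + 1) ω =
    (1 - gam γs (k + 1)) • A.theta n k ω + gam γs (k + 1) • A.emp n (k + 1) ω := by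
  ext x
  rw [A.theta_rec]
  simp only [Pi.add_apply, Pi.smul_apply, smul_eq_mul, emp]
  ring

lemma theta_mem_simplex (hγ : 0 < γs) (ha : ∀ n, 0 < a n) (n k : ℕ) (ω : Ω) :
    A.theta n k ω ∈ simplex d := by
  induction k with
  | zero =>
    rw [A.theta_zero]
    refine ⟨fun x => ?_, by simp⟩
    simp only
    split_ifs <;> norm_num
  | succ k ih =>
    rw [A.theta_succ]
    have h0 := gam_succ_nonneg hγ k
    have h1 := gam_succ_le_one γs k
    have he := A.emp_mem_simplex ha n (k + 1) ω
    refine ⟨fun x => add_nonneg (mul_nonneg (by linarith) (ih.1 x)) (mul_nonneg h0 (he.1 x)), ?_⟩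
    simp only [Pi.add_apply, Pi.smul_apply, smul_eq_mul, Finset.sum_add_distrib,
      ← Finset.mul_sum, ih.2, he.2]
    ring

/-- The one-step transition law of a single particle. -/
lemma condExp_particle [IsProbabilityMeasure μ] (hS : Setup d P pi) (hγ : 0 < γs)
    (ha : ∀ n, 0 < a n) (n k : ℕ) {i : ℕ} (hi : i < a n) (y : Fin d) :
    μ[fun ω => if A.X n (k + 1) i ω = y then (1 : ℝ) else 0 | A.F n k] =ᵐ[μ]
      fun ω => Kmat P (A.theta n k ω) (A.X n k i ω) y := by
  set i₀ : Fin (a n) := ⟨i, hi⟩ with hi₀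
  set t : Fin (a n) → Finset (Fin d) := fun i => if i = i₀ then {y} else Finset.univ with ht
  set ext : (Fin (a n) → Fin d) → ℕ → Fin d :=
    fun f i => if h : i < a n then f ⟨i, h⟩ else x0 with hext
  have hextv : ∀ f (i : Fin (a n)), ext f i = f i := fun f i => by simp [hext]
  set s : (Fin (a n) → Fin d) → Set Ω :=
    fun f => {ω | ∀ i < a n, A.X n (k + 1) i ω = ext f i} with hs
  have hXm : ∀ i, Measurable (A.X n (k + 1) i) := fun i =>
    (A.X_adapted n (k + 1) i).mono (A.F_le n (k + 1)) le_rfl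
  have hsm : ∀ f, MeasurableSet (s f) := by
    intro f
    have : s f = ⋂ i, ⋂ (_ : i < a n), A.X n (k + 1) i ⁻¹' {ext f i} := by
      ext ω; simp [hs]
    rw [this]
    exact MeasurableSet.iInter fun i => MeasurableSet.iInter fun _ =>
      hXm i (MeasurableSet.singleton _)
  have hsum : (fun ω => if A.X n (k + 1) i ω = y then (1 : ℝ) else 0) =
      ∑ f ∈ Fintype.piFinset t, (s f).indicator fun _ => (1 : ℝ) := by
    funext ω
    rw [Finset.sum_apply]
    have hmem : ∀ f, ω ∈ s f ↔ f = fun i : Fin (a n) => A.X n (k + 1) i ω := by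
      intro f
      constructor
      · intro h
        funext j
        rw [h j j.2, hextv]
      · rintro rfl j hj
        exact (hextv (fun i : Fin (a n) => A.X n (k + 1) i ω) ⟨j, hj⟩).symm
    have hpi : (fun i : Fin (a n) => A.X n (k + 1) i ω) ∈ Fintype.piFinset t ↔
        A.X n (k + 1) i ω = y := by
      rw [Fintype.mem_piFinset]
      constructor
      · intro h
        simpa [ht] using h i₀
      · intro h j
        by_cases hj : j = i₀
        · subst hj; simpa [ht] using h
        · simp [ht, hj]
    simp only [Set.indicator_apply, hmem, Finset.sum_ite_eq', hpi]
  have hK : ∀ ω, ∑ f ∈ Fintype.piFinset t,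
      ∏ j ∈ Finset.range (a n), Kmat P (A.theta n k ω) (A.X n k j ω) (ext f j) =
        Kmat P (A.theta n k ω) (A.X n k i ω) y := by
    intro ω
    simp only [Finset.prod_range, hextv]
    rw [← Finset.prod_univ_sum t fun (j : Fin (a n)) z =>
      Kmat P (A.theta n k ω) (A.X n k j ω) z, Finset.prod_eq_single i₀]
    · simp [ht, hi₀]
    · intro j _ hj
      simp only [ht, if_neg hj]
      exact hS.Kmat_rowsum (A.theta_mem_simplex hγ ha n k ω) _
    · intro h; exact absurd (Finset.mem_univ _) h
  rw [hsum]
  have h1 := condExp_finsetSum (μ := μ) (s := Fintype.piFinset t)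
    (f := fun f => (s f).indicator fun _ => (1 : ℝ))
    (fun f _ => (integrable_const (1 : ℝ)).indicator (hsm f)) (A.F n k)
  have h2 : ∀ᵐ ω ∂μ, ∀ f ∈ Fintype.piFinset t, (μ[(s f).indicator fun _ => (1 : ℝ) | A.F n k]) ω =
      ∏ j ∈ Finset.range (a n), Kmat P (A.theta n k ω) (A.X n k j ω) (ext f j) :=
    (ae_ball_iff (Finset.countable_toSet _)).2 fun f _ => A.law n k (ext f)
  filter_upwards [h1, h2] with ω h3 h4
  rw [h3, Finset.sum_apply, Finset.sum_congr rfl h4, hK]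

/-- The martingale increment of the empirical measure. -/
def noise (n k : ℕ) (x : Fin d) (ω : Ω) : ℝ :=
  A.emp n (k + 1) ω x - ∑ z, A.emp n k ω z * Kmat P (A.theta n k ω) z x

lemma measurable_indicator_X (n k i : ℕ) (x : Fin d) :
    Measurable[A.F n k] fun ω => if A.X n k i ω = x then (1 : ℝ) else 0 :=
  (measurable_of_finite fun z : Fin d => if z = x then (1 : ℝ) else 0).comp (A.X_adapted n k i)

lemma measurable_emp (n k : ℕ) (x : Fin d) : Measurable[A.F n k] fun ω => A.emp n k ω x :=
  (Finset.measurable_fun_sum _ fun i _ => A.measurable_indicator_X n k i x).const_mul _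

lemma measurable_Kmat (n k : ℕ) (z x : Fin d) :
    Measurable[A.F n k] fun ω => Kmat P (A.theta n k ω) z x :=
  (((measurable_pi_apply x).comp (A.theta_adapted n k)).const_mul (P z.succ 0)).const_add _

lemma measurable_noise (n k : ℕ) (x : Fin d) : Measurable[A.F n (k + 1)] (A.noise n k x) := by
  refine Measurable.sub (A.measurable_emp n (k + 1) x) (Finset.measurable_fun_sum _ fun z _ => ?_)
  exact ((A.measurable_emp n k z).mul (A.measurable_Kmat n k z x)).mono
    (A.F_mono n (Nat.le_succ k)) le_rfl

lemma abs_noise_le (hS : Setup d P pi) (hγ : 0 < γs) (ha : ∀ n, 0 < a n) (n k : ℕ) (x : Fin d)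
    (ω : Ω) : |A.noise n k x ω| ≤ 1 := by
  have hθ := A.theta_mem_simplex hγ ha n k ω
  have he := A.emp_mem_simplex ha n k ω
  have he' := A.emp_mem_simplex ha n (k + 1) ω
  have h1 : 0 ≤ ∑ z, A.emp n k ω z * Kmat P (A.theta n k ω) z x :=
    Finset.sum_nonneg fun z _ => mul_nonneg (he.1 z) (hS.Kmat_nonneg hθ z x)
  have h2 : ∑ z, A.emp n k ω z * Kmat P (A.theta n k ω) z x ≤ 1 := by
    rw [← he.2]
    exact Finset.sum_le_sum fun z _ => mul_le_of_le_one_right (he.1 z) (hS.Kmat_le_one hθ z x)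
  have h3 := he'.1 x
  have h4 : A.emp n (k + 1) ω x ≤ 1 :=
    he'.2 ▸ Finset.single_le_sum (fun y _ => he'.1 y) (Finset.mem_univ x)
  rw [noise, abs_le]
  constructor <;> linarith

lemma condExp_noise [IsProbabilityMeasure μ] (hS : Setup d P pi) (hγ : 0 < γs)
    (ha : ∀ n, 0 < a n) (n k : ℕ) (x : Fin d) : μ[A.noise n k x | A.F n k] =ᵐ[μ] 0 := by
  set I : ℕ → Ω → ℝ := fun i ω => if A.X n (k + 1) i ω = x then (1 : ℝ) else 0 with hI
  set K : Ω → ℝ := fun ω => ∑ z, A.emp n k ω z * Kmat P (A.theta n k ω) z x with hK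
  have hKm : Measurable[A.F n k] K := Finset.measurable_fun_sum _ fun z _ =>
    (A.measurable_emp n k z).mul (A.measurable_Kmat n k z x)
  have hIi : ∀ i, Integrable (I i) μ := fun i =>
    Integrable.of_bound ((A.measurable_indicator_X n (k + 1) i x).mono
      (A.F_le n (k + 1)) le_rfl).aestronglyMeasurable 1
      (ae_of_all _ fun ω => by simp only [hI]; split_ifs <;> simp)
  have hEi : Integrable ((a n : ℝ)⁻¹ • ∑ i ∈ Finset.range (a n), I i) μ :=
    (integrable_finsetSum' _ fun i _ => hIi i).smul _
  have hnoise : A.noise n k x = (a n : ℝ)⁻¹ • ∑ i ∈ Finset.range (a n), I i - K := by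
    funext ω
    simp only [noise, emp, hI, hK, Pi.sub_apply, Pi.smul_apply, Finset.sum_apply, smul_eq_mul]
  have hKi : Integrable K μ := by
    have h1 : K = (a n : ℝ)⁻¹ • ∑ i ∈ Finset.range (a n), I i - A.noise n k x := by
      rw [hnoise, sub_sub_cancel]
    rw [h1]
    exact hEi.sub (Integrable.of_bound ((A.measurable_noise n k x).mono
      (A.F_le n (k + 1)) le_rfl).aestronglyMeasurable 1
      (ae_of_all _ fun ω => A.abs_noise_le hS hγ ha n k x ω))
  have h1 := condExp_sub hEi hKi (A.F n k)
  have h2 := condExp_smul (μ := μ) (a n : ℝ)⁻¹ (∑ i ∈ Finset.range (a n), I i) (A.F n k)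
  have h3 := condExp_finsetSum (μ := μ) (s := Finset.range (a n)) (f := I)
    (fun i _ => hIi i) (A.F n k)
  have h4 : ∀ᵐ ω ∂μ, ∀ i ∈ Finset.range (a n), (μ[I i | A.F n k]) ω =
      Kmat P (A.theta n k ω) (A.X n k i ω) x :=
    (ae_ball_iff (Finset.countable_toSet _)).2 fun i hi =>
      A.condExp_particle hS hγ ha n k (Finset.mem_range.1 hi) x
  have h5 := condExp_of_stronglyMeasurable (μ := μ) (A.F_le n k) hKm.stronglyMeasurable hKi
  rw [hnoise]
  filter_upwards [h1, h2, h3, h4] with ω e1 e2 e3 e4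
  rw [e1, Pi.sub_apply, e2, Pi.smul_apply, e3, Finset.sum_apply, Finset.sum_congr rfl e4, h5,
    Pi.zero_apply, smul_eq_mul, hK]
  simp only
  rw [A.sum_emp_mul n k ω fun z => Kmat P (A.theta n k ω) z x, sub_self]

/-- Azuma's inequality for the weighted noise between times `j` and `l`. -/
lemma measure_noise_ge_le [IsProbabilityMeasure μ] (hS : Setup d P pi) (hγ : 0 < γs)
    (ha : ∀ n, 0 < a n) (n : ℕ) (x : Fin d) {j l : ℕ} (hj : 1 ≤ j) (hjl : j ≤ l) {δ : ℝ}
    (hδ : 0 ≤ δ) :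
    μ.real {ω | δ ≤ |∑ k ∈ Finset.Ico j l, gam γs (k + 1) * A.noise n (k + 1) x ω|} ≤
      2 * Real.exp (-(δ ^ 2 * j / (4 * γs ^ 2))) := by
  have hj0 : (0 : ℝ) < j := Nat.cast_pos.2 hj
  have h := measure_abs_sum_Ico_ge_le (μ := μ) (ℱ := fun k => A.F n (k + 1))
    (D := fun k ω => gam γs (k + 1) * A.noise n (k + 1) x ω) (b := fun k => gam γs (k + 1))
    (fun k => A.F_le n _) (fun i k hik => A.F_mono n (by omega))
    (fun k => (A.measurable_noise n (k + 1) x).const_mul _)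
    (fun k ω => by
      rw [abs_mul, abs_of_nonneg (gam_succ_nonneg hγ k)]
      exact mul_le_of_le_one_right (gam_succ_nonneg hγ k) (A.abs_noise_le hS hγ ha n _ x ω))
    (fun k => by
      have h1 := condExp_smul (μ := μ) (gam γs (k + 1)) (A.noise n (k + 1) x) (A.F n (k + 1))
      filter_upwards [h1, A.condExp_noise hS hγ ha n (k + 1) x] with ω e1 e2
      refine e1.trans ?_
      rw [Pi.smul_apply, e2, Pi.zero_apply, smul_zero])
    hjl (B := γs ^ 2 / j) (by positivity)
    ((sum_gam_sq_le hγ hj hjl).trans (by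
      rw [div_eq_mul_one_div (γs ^ 2) (j : ℝ)]
      have : (0 : ℝ) ≤ 1 / l := by positivity
      exact mul_le_mul_of_nonneg_left (by linarith) (sq_nonneg γs))) hδ
  refine h.trans_eq ?_
  congr 3
  field_simp


/-- Almost surely, the weighted noise after time `n ^ (p / 2)` is eventually at most
`n ^ (-p / 8)`. -/
lemma ae_eventually_abs_sum_noise_le [IsProbabilityMeasure μ] (hS : Setup d P pi) (hγ : 0 < γs)
    (ha : ∀ n, 0 < a n) {p : ℝ} (hp : 0 < p) :
    ∀ᵐ ω ∂μ, ∀ᶠ n : ℕ in atTop, ∀ i, ⌈(n : ℝ) ^ (p / 2)⌉₊ ≤ i → i ≤ n → ∀ x,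
      |∑ k ∈ Finset.Ico ⌈(n : ℝ) ^ (p / 2)⌉₊ i, gam γs (k + 1) * A.noise n (k + 1) x ω| ≤
        (n : ℝ) ^ (-(p / 8)) := by
  set j : ℕ → ℕ := fun n => ⌈(n : ℝ) ^ (p / 2)⌉₊ with hj
  set s : ℕ → Set Ω := fun n => ⋃ i ∈ Finset.Icc (j n) n, ⋃ x ∈ (Finset.univ : Finset (Fin d)),
    {ω | (n : ℝ) ^ (-(p / 8)) ≤
      |∑ k ∈ Finset.Ico (j n) i, gam γs (k + 1) * A.noise n (k + 1) x ω|} with hs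
  set c : ℝ := (4 * γs ^ 2)⁻¹ with hc
  have hc0 : 0 < c := by positivity
  have hsn : ∀ n : ℕ, 1 ≤ n →
      μ.real (s n) ≤ (n + 1) * (d * (2 * Real.exp (-c * (n : ℝ) ^ (p / 4)))) := by
    intro n hn
    have hn0 : (0 : ℝ) < n := Nat.cast_pos.2 hn
    have hj1 : 1 ≤ j n := Nat.one_le_ceil_iff.2 (Real.rpow_pos_of_pos hn0 _)
    have hδj : (n : ℝ) ^ (p / 4) ≤ ((n : ℝ) ^ (-(p / 8))) ^ 2 * j n := by
      have h1 : (n : ℝ) ^ (p / 2) ≤ j n := Nat.le_ceil _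
      calc (n : ℝ) ^ (p / 4) = ((n : ℝ) ^ (-(p / 8))) ^ 2 * (n : ℝ) ^ (p / 2) := by
            rw [← Real.rpow_natCast, ← Real.rpow_mul hn0.le, ← Real.rpow_add hn0]
            congr 1; push_cast; ring
        _ ≤ _ := by gcongr
    have hle : ∀ i ∈ Finset.Icc (j n) n, ∀ x : Fin d, μ.real {ω | (n : ℝ) ^ (-(p / 8)) ≤
        |∑ k ∈ Finset.Ico (j n) i, gam γs (k + 1) * A.noise n (k + 1) x ω|} ≤
          2 * Real.exp (-c * (n : ℝ) ^ (p / 4)) := by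
      intro i hi x
      refine (A.measure_noise_ge_le hS hγ ha n x hj1 (Finset.mem_Icc.1 hi).1
        (by positivity)).trans ?_
      gcongr
      rw [neg_mul, neg_le_neg_iff, div_eq_inv_mul _ (4 * γs ^ 2)]
      exact mul_le_mul_of_nonneg_left hδj hc0.le
    calc μ.real (s n) ≤ ∑ i ∈ Finset.Icc (j n) n, ∑ x : Fin d,
          2 * Real.exp (-c * (n : ℝ) ^ (p / 4)) :=
        (measureReal_biUnion_finset_le _ _).trans (Finset.sum_le_sum fun i hi =>
          (measureReal_biUnion_finset_le _ _).trans (Finset.sum_le_sum fun x _ => hle i hi x))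
      _ = ((n + 1 - j n : ℕ) : ℝ) * (d * (2 * Real.exp (-c * (n : ℝ) ^ (p / 4)))) := by
        simp
      _ ≤ _ := by
        gcongr
        exact_mod_cast Nat.sub_le _ _
  have hexp : ∀ᶠ n : ℕ in atTop, Real.exp (-c * (n : ℝ) ^ (p / 4)) ≤ (n : ℝ) ^ (-3 : ℝ) := by
    have h := ((isLittleO_exp_neg_mul_rpow_atTop hc0 (-3 / (p / 4))).bound one_pos)
    have h1 := ((tendsto_rpow_atTop (by positivity : 0 < p / 4)).comp
      (tendsto_natCast_atTop_atTop (R := ℝ))).eventually h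
    filter_upwards [h1] with n hn
    simp only [Function.comp] at hn
    rw [← Real.rpow_mul (Nat.cast_nonneg n), mul_div_cancel₀ _ (by positivity), one_mul,
      Real.norm_of_nonneg (Real.exp_pos _).le, Real.norm_of_nonneg (by positivity)] at hn
    exact hn
  have hsum : Summable fun n => μ.real (s n) := by
    refine Summable.of_norm_bounded_eventually_nat (g := fun n : ℕ => 4 * d * (n : ℝ) ^ (-2 : ℝ))
      ((Real.summable_nat_rpow.2 (by norm_num)).mul_left _) ?_
    filter_upwards [hexp, eventually_ge_atTop 1] with n hn hn1
    have hn0 : (0 : ℝ) < n := Nat.cast_pos.2 hn1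
    have hn1' : (1 : ℝ) ≤ n := Nat.one_le_cast.2 hn1
    rw [Real.norm_of_nonneg measureReal_nonneg]
    calc μ.real (s n) ≤ (n + 1) * (d * (2 * Real.exp (-c * (n : ℝ) ^ (p / 4)))) := hsn n hn1
      _ ≤ (n + n) * (d * (2 * (n : ℝ) ^ (-3 : ℝ))) := by gcongr
      _ = 4 * d * ((n : ℝ) ^ (1 : ℝ) * (n : ℝ) ^ (-3 : ℝ)) := by rw [Real.rpow_one]; ring
      _ = 4 * d * (n : ℝ) ^ (-2 : ℝ) := by rw [← Real.rpow_add hn0]; norm_num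
  have hfin : ∑' n, μ (s n) ≠ ⊤ := by
    have h : ∀ n, μ (s n) = ENNReal.ofReal (μ.real (s n)) := fun n =>
      (ofReal_measureReal (measure_ne_top μ _)).symm
    simp only [h]
    exact hsum.tsum_ofReal_ne_top
  filter_upwards [ae_eventually_notMem hfin] with ω hω
  filter_upwards [hω] with n hn i hji hin x
  by_contra! hlt
  exact hn (Set.mem_biUnion (Finset.mem_Icc.2 ⟨hji, hin⟩)
    (Set.mem_biUnion (Finset.mem_univ x) hlt.le))

end AlgorithmI

/-- Powers dominate a sum of two faster decaying terms, one of them with a logarithm. -/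
lemma eventually_rpow_add_log_le (C γ : ℝ) {b b₁ b₂ : ℝ} (h₁ : b < b₁) (h₂ : b < b₂) :
    ∀ᶠ x : ℝ in atTop, C * (x ^ (-b₁) + x ^ (-b₂) * (1 + γ * Real.log x)) ≤ x ^ (-b) := by
  have hb : 0 < b₂ - b := sub_pos.2 h₂
  have hlog : Tendsto (fun x : ℝ => Real.log x * x ^ (-(b₂ - b))) atTop (𝓝 0) := by
    have h := (isLittleO_log_rpow_atTop hb).tendsto_div_nhds_zero
    refine h.congr' ?_
    filter_upwards [eventually_ge_atTop 0] with x hx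
    rw [Real.rpow_neg hx, div_eq_mul_inv]
  have h1 := tendsto_rpow_neg_atTop (sub_pos.2 h₁)
  have h2 := tendsto_rpow_neg_atTop hb
  have h := (h1.add (h2.add (hlog.const_mul γ))).const_mul C
  simp only [mul_zero, add_zero] at h
  filter_upwards [h.eventually (ge_mem_nhds one_pos), eventually_gt_atTop 0] with x hx hx0
  have e1 : x ^ (-b₁) = x ^ (-(b₁ - b)) * x ^ (-b) := by rw [← Real.rpow_add hx0]; ring_nf
  have e2 : x ^ (-b₂) = x ^ (-(b₂ - b)) * x ^ (-b) := by rw [← Real.rpow_add hx0]; ring_nf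
  calc C * (x ^ (-b₁) + x ^ (-b₂) * (1 + γ * Real.log x))
      = C * (x ^ (-(b₁ - b)) + (x ^ (-(b₂ - b)) + γ * (Real.log x * x ^ (-(b₂ - b))))) *
          x ^ (-b) := by rw [e1, e2]; ring
    _ ≤ 1 * x ^ (-b) := by gcongr
    _ = x ^ (-b) := one_mul _

namespace AlgorithmI

/-- Almost sure polynomial rate of convergence between the times `n ^ p` and `n`. -/
lemma exists_rate (A : AlgorithmI d P γs a x0 Ω μ) [IsProbabilityMeasure μ] {θs : Fin d → ℝ}
    (hd : 0 < d) (hS : Setup d P pi) (hQSD : IsQSD d P pi θs) (hγ : 0 < γs) (ha : ∀ n, 0 < a n) {p : ℝ}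
    (hp : p ∈ Set.Ioo (0 : ℝ) 1) :
    ∃ β : ℝ, 0 < β ∧ ∀ᵐ ω ∂μ, ∃ n0 : ℕ, ∀ n ≥ n0, ∀ k : ℕ,
      (n : ℝ) ^ p ≤ (k : ℝ) → k ≤ n → ‖A.theta n k ω - θs‖ ≤ (k : ℝ) ^ (-β) := by
  obtain ⟨C, κ, δ₀, hC, hκ, hδ₀, hmain⟩ := hS.exists_norm_sub_le hd hQSD hγ
  obtain ⟨hp0, hp1⟩ := hp
  set β : ℝ := min (p * κ / 8) (p / 16) with hβ
  have hβ0 : 0 < β := lt_min (by positivity) (by positivity)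
  have hβ1 : β < p / 4 * κ := (min_le_left _ _).trans_lt (by nlinarith [mul_pos hp0 hκ])
  have hβ2 : β < p / 8 := (min_le_right _ _).trans_lt (by linarith)
  set M : ℝ := ((⌊γs⌋₊ + 1 : ℕ) : ℝ) with hM
  have hM0 : 0 ≤ M := Nat.cast_nonneg _
  have hcast := tendsto_natCast_atTop_atTop (R := ℝ)
  have hrate := hcast.eventually (eventually_rpow_add_log_le C γs hβ1 hβ2)
  have hδ : ∀ᶠ n : ℕ in atTop, (n : ℝ) ^ (-(p / 8)) ≤ δ₀ :=
    ((tendsto_rpow_neg_atTop (by positivity : 0 < p / 8)).comp hcast).eventually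
      (ge_mem_nhds hδ₀)
  have hbig : ∀ {q : ℝ}, 0 < q → ∀ K : ℝ, ∀ᶠ n : ℕ in atTop, K ≤ (n : ℝ) ^ q := fun hq K =>
    ((tendsto_rpow_atTop hq).comp hcast).eventually (eventually_ge_atTop K)
  refine ⟨β, hβ0, ?_⟩
  filter_upwards [A.ae_eventually_abs_sum_noise_le hS hγ ha hp0] with ω hω
  rw [← eventually_atTop]
  filter_upwards [hω, hrate, hδ, hbig (by positivity : 0 < p * 3 / 8) γs,
    hbig (by positivity : 0 < p / 4) 2, hbig (by positivity : 0 < p / 2) (1 + M),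
    eventually_ge_atTop 1] with n hnoise hr hδn hγn h2n hMn hn1 l hpl hln
  have hn0 : (0 : ℝ) < n := Nat.cast_pos.2 hn1
  have hn1' : (1 : ℝ) ≤ n := Nat.one_le_cast.2 hn1
  have hl0 : (0 : ℝ) < l := (Real.rpow_pos_of_pos hn0 p).trans_le hpl
  have hl1 : (1 : ℝ) ≤ l := Nat.one_le_cast.2 (Nat.cast_pos.1 hl0)
  have hln' : (l : ℝ) ≤ n := Nat.cast_le.2 hln
  set j := ⌈(n : ℝ) ^ (p / 2)⌉₊ with hj
  have hj1 : 1 ≤ j := Nat.one_le_ceil_iff.2 (Real.rpow_pos_of_pos hn0 _)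
  have hjl : j ≤ l := Nat.ceil_le.2
    ((Real.rpow_le_rpow_of_exponent_le hn1' (by linarith)).trans hpl)
  have hjle : (j : ℝ) ≤ (n : ℝ) ^ (p / 2) + 1 := (Nat.ceil_lt_add_one (by positivity)).le
  have hγj : γs / j ≤ (n : ℝ) ^ (-(p / 8)) := by
    rw [div_le_iff₀ (Nat.cast_pos.2 hj1)]
    calc γs ≤ (n : ℝ) ^ (p * 3 / 8) := hγn
      _ = (n : ℝ) ^ (-(p / 8)) * (n : ℝ) ^ (p / 2) := by
        rw [← Real.rpow_add hn0]; ring_nf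
      _ ≤ _ := by gcongr; exact Nat.le_ceil _
  have hratio : ((j + M) / (l + M) : ℝ) ≤ (n : ℝ) ^ (-(p / 4)) := by
    rw [div_le_iff₀ (by positivity)]
    calc (j + M : ℝ) ≤ 2 * (n : ℝ) ^ (p / 2) := by linarith
      _ ≤ (n : ℝ) ^ (p / 4) * (n : ℝ) ^ (p / 2) := by gcongr
      _ = (n : ℝ) ^ (-(p / 4)) * (n : ℝ) ^ p := by
        rw [← Real.rpow_add hn0, ← Real.rpow_add hn0]; ring_nf
      _ ≤ (n : ℝ) ^ (-(p / 4)) * (l + M) := by gcongr; linarith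
  calc ‖A.theta n l ω - θs‖
      ≤ C * (((j + M) / (l + M)) ^ κ + (n : ℝ) ^ (-(p / 8)) * (1 + γs * Real.log l)) :=
        hmain (fun k => A.theta n k ω) (fun k => A.emp n k ω) j l _ hj1 hjl hδn hγj
          (fun k => A.theta_mem_simplex hγ ha n k ω) (fun k => A.emp_mem_simplex ha n k ω)
          (fun k => A.theta_succ n k ω) (fun i hji hil x => hnoise i hji (hil.trans hln) x)
    _ ≤ C * (((n : ℝ) ^ (-(p / 4))) ^ κ +
          (n : ℝ) ^ (-(p / 8)) * (1 + γs * Real.log n)) := by gcongr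
    _ = C * ((n : ℝ) ^ (-(p / 4 * κ)) + (n : ℝ) ^ (-(p / 8)) * (1 + γs * Real.log n)) := by
        rw [← Real.rpow_mul hn0.le, neg_mul]
    _ ≤ (n : ℝ) ^ (-β) := hr
    _ ≤ (l : ℝ) ^ (-β) := Real.rpow_le_rpow_of_nonpos hl0 hln' (by linarith)

end AlgorithmI

end Algorithm

/-- **Theorem (a.s. convergence and rate for Algorithm I).**
`θ^n_n → θ*` a.s., and for each `p ∈ (0,1)` there is `β > 0` such that a.s.,
eventually in `n`, `‖θ^n_k - θ*‖ ≤ k^{-β}` for all `n^p ≤ k ≤ n`. -/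
theorem algorithmI_as_convergence_and_rate
    {d : ℕ} (hd : 0 < d) (P : Matrix (Fin (d + 1)) (Fin (d + 1)) ℝ)
    (pi : (Fin d → ℝ) → Fin d → ℝ) (θs : Fin d → ℝ) (γs : ℝ) (a : ℕ → ℕ) (x0 : Fin d)
    (Ω : Type) [MeasurableSpace Ω] (μ : Measure Ω) [IsProbabilityMeasure μ]
    (hS : Setup d P pi) (hQSD : IsQSD d P pi θs) (hγpos : 0 < γs)
    (ha_pos : ∀ n, 0 < a n) (ha_mono : Monotone a) (ha_top : Tendsto a atTop atTop)
    (A : AlgorithmI d P γs a x0 Ω μ) :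
    (∀ᵐ ω ∂μ, Tendsto (fun n => A.theta n n ω) atTop (𝓝 θs)) ∧
      ∀ p ∈ Set.Ioo (0 : ℝ) 1, ∃ β : ℝ, 0 < β ∧ ∀ᵐ ω ∂μ, ∃ n0 : ℕ, ∀ n ≥ n0, ∀ k : ℕ,
        (n : ℝ) ^ p ≤ (k : ℝ) → k ≤ n →
          ‖A.theta n k ω - θs‖ ≤ (k : ℝ) ^ (-β) := by
  have hrate : ∀ p ∈ Set.Ioo (0 : ℝ) 1, ∃ β : ℝ, 0 < β ∧ ∀ᵐ ω ∂μ, ∃ n0 : ℕ, ∀ n ≥ n0, ∀ k : ℕ,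
      (n : ℝ) ^ p ≤ (k : ℝ) → k ≤ n → ‖A.theta n k ω - θs‖ ≤ (k : ℝ) ^ (-β) :=
    fun p hp => A.exists_rate hd hS hQSD hγpos ha_pos hp
  refine ⟨?_, hrate⟩
  obtain ⟨β, hβ, h⟩ := hrate (1 / 2) ⟨by norm_num, by norm_num⟩
  filter_upwards [h] with ω ⟨n0, hω⟩
  rw [tendsto_iff_norm_sub_tendsto_zero]
  refine squeeze_zero' (Eventually.of_forall fun n => norm_nonneg _) ?_
    ((tendsto_rpow_neg_atTop hβ).comp tendsto_natCast_atTop_atTop)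
  filter_upwards [eventually_ge_atTop n0, eventually_ge_atTop 1] with n hn hn1
  refine hω n hn n ?_ le_rfl
  calc (n : ℝ) ^ (1 / 2 : ℝ) ≤ (n : ℝ) ^ (1 : ℝ) :=
        Real.rpow_le_rpow_of_exponent_le (Nat.one_le_cast.2 hn1) (by norm_num)
    _ = n := Real.rpow_one _

end QSDPaper
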